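/- arXiv:2405.11851 — 3 statements merged into one kernel-verified Lean document; each statement's English description precedes it below -/
import Mathlib

section
/- (Maximal inequality for the fractional integral of a Gaussian process.) Let {X(t)}_{0≤t≤1} be a centered real-valued Gaussian process with continuous sample paths and X(0) = 0, let θ > 0 and define Y(s) = (1/Γ(θ)) ∫₀^{s} (s−w)^{θ−1} X(w) dw for 0 ≤ s ≤ 1. Suppose there exist constants η > 0 and c_Y > 0 such that (E[(Y(s+h) − Y(s))²])^{1/2} ≤ c_Y h^{η} for all h ∈ (0,1) and 0 ≤ s ≤ s+h ≤ 1. Then there exists a constant c > 0, independent of c_Y and δ, such that for every δ > c_Y: P( sup_{0≤s≤1} |Y(s)| ≥ δ ) ≤ (1/c) exp( −c (δ/c_Y)² ). -/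
open MeasureTheory ProbabilityTheory Real Set Filter

/-- A process is a centered Gaussian process if every finite linear combination of its
values has a centered Gaussian distribution. -/
def IsCenteredGaussianProcess {Ω : Type*} [MeasurableSpace Ω] (P : Measure Ω)
    (X : ℝ → Ω → ℝ) : Prop :=
  ∀ (n : ℕ) (t : Fin n → ℝ) (c : Fin n → ℝ), ∃ v : NNReal,
    P.map (fun ω => ∑ i, c i * X (t i) ω) = ProbabilityTheory.gaussianReal 0 v

/-- The fractional integral `Y(s) = (1/Γ(θ)) ∫₀^s (s−w)^{θ−1} X(w) dw` of a process `X`. -/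
noncomputable def fracInt {Ω : Type*} (θ : ℝ) (X : ℝ → Ω → ℝ) (t : ℝ) (ω : Ω) : ℝ :=
  (Real.Gamma θ)⁻¹ * ∫ u in (0:ℝ)..t, (t - u) ^ (θ - 1) * X u ω

theorem tendsto_sum_integral_mul {k g : ℝ → ℝ} (hk : IntervalIntegrable k volume 0 1)
    (hg : Continuous g) :
    Tendsto (fun m : ℕ => ∑ j ∈ Finset.range (m + 1),
      (∫ u in ((j : ℝ) / (m + 1))..((j + 1 : ℝ) / (m + 1)), k u) * g ((j + 1) / (m + 1)))
      atTop (nhds (∫ u in (0 : ℝ)..1, k u * g u)) := by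
  obtain ⟨C, hC⟩ := (isCompact_Icc (a := (0 : ℝ)) (b := 1)).exists_bound_of_continuousOn
    hg.continuousOn
  have hmeas : ∀ m : ℕ, Measurable fun u : ℝ => g ((⌈u * (m + 1)⌉₊ : ℝ) / (m + 1)) := fun m =>
    hg.measurable.comp (((measurable_from_nat (f := fun n : ℕ => (n : ℝ))).comp
      (Nat.measurable_ceil.comp (measurable_id.mul_const _))).div_const _)
  have hmem : ∀ (m : ℕ) (u : ℝ), u ∈ Set.uIoc (0 : ℝ) 1 →
      (⌈u * (m + 1)⌉₊ : ℝ) / (m + 1) ∈ Set.Icc (0 : ℝ) 1 := by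
    intro m u hu
    rw [Set.uIoc_of_le zero_le_one] at hu
    refine ⟨by positivity, ?_⟩
    rw [div_le_one (by positivity)]
    have : ⌈u * (m + 1)⌉₊ ≤ m + 1 := by
      apply Nat.ceil_le.2
      push_cast
      nlinarith [hu.2, (Nat.cast_nonneg m : (0 : ℝ) ≤ m)]
    exact_mod_cast this
  have hbound : ∀ (m : ℕ) (u : ℝ), u ∈ Set.uIoc (0 : ℝ) 1 →
      ‖k u * g ((⌈u * (m + 1)⌉₊ : ℝ) / (m + 1))‖ ≤ ‖k u‖ * C := by
    intro m u hu
    rw [norm_mul]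
    exact mul_le_mul_of_nonneg_left (hC _ (hmem m u hu)) (norm_nonneg _)
  have hstrong : ∀ m : ℕ, AEStronglyMeasurable
      (fun u => k u * g ((⌈u * (m + 1)⌉₊ : ℝ) / (m + 1)))
      (volume.restrict (Set.uIoc (0 : ℝ) 1)) := fun m =>
    hk.aestronglyMeasurable_restrict_uIoc.mul (hmeas m).aestronglyMeasurable
  have hint : ∀ m : ℕ, IntervalIntegrable
      (fun u => k u * g ((⌈u * (m + 1)⌉₊ : ℝ) / (m + 1))) volume 0 1 := by
    intro m
    refine (hk.norm.mul_const C).mono_fun (hstrong m) ?_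
    refine (ae_restrict_iff' measurableSet_uIoc).2 (ae_of_all _ fun u hu => ?_)
    exact (hbound m u hu).trans (le_abs_self _)
  have hsum : ∀ m : ℕ, ∑ j ∈ Finset.range (m + 1),
      (∫ u in ((j : ℝ) / (m + 1))..((j + 1 : ℝ) / (m + 1)), k u) * g ((j + 1) / (m + 1))
      = ∫ u in (0 : ℝ)..1, k u * g ((⌈u * (m + 1)⌉₊ : ℝ) / (m + 1)) := by
    intro m
    have hm : (0 : ℝ) < m + 1 := by positivity
    have h := intervalIntegral.sum_integral_adjacent_intervals (μ := volume)
      (f := fun u => k u * g ((⌈u * (m + 1)⌉₊ : ℝ) / (m + 1)))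
      (a := fun j : ℕ => (j : ℝ) / (m + 1)) (n := m + 1) ?_
    · simp only [Nat.cast_zero, zero_div, Nat.cast_add, Nat.cast_one, div_self hm.ne'] at h
      rw [← h]
      refine Finset.sum_congr rfl fun j _ => ?_
      rw [← intervalIntegral.integral_mul_const]
      refine intervalIntegral.integral_congr_ae (ae_of_all _ fun u hu => ?_)
      rw [Set.uIoc_of_le (by gcongr; linarith)] at hu
      have : ⌈u * (m + 1)⌉₊ = j + 1 := by
        rw [Nat.ceil_eq_iff (by omega)]
        have h1 := (div_lt_iff₀ hm).1 hu.1
        have h2 := (le_div_iff₀ hm).1 hu.2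
        exact ⟨by simpa using h1, by push_cast; exact h2⟩
      rw [this]
      push_cast
      rfl
    · intro j hj
      refine (hint m).mono_set ?_
      have hj' : (j : ℝ) + 1 ≤ m + 1 := by exact_mod_cast hj
      have hj0 : (0 : ℝ) ≤ j := Nat.cast_nonneg j
      rw [Set.uIcc_of_le (by gcongr; simp), Set.uIcc_of_le zero_le_one]
      refine Set.Icc_subset_Icc (by positivity) ?_
      rw [div_le_one hm]
      push_cast
      exact hj'
  simp_rw [hsum]
  refine intervalIntegral.tendsto_integral_filter_of_dominated_convergence
    (fun u => ‖k u‖ * C) (Eventually.of_forall hstrong)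
    (Eventually.of_forall fun m => ae_of_all _ (hbound m)) (hk.norm.mul_const C)
    (ae_of_all _ fun u hu => ?_)
  rw [Set.uIoc_of_le zero_le_one] at hu
  refine ((hg.tendsto u).comp ?_).const_mul _
  have h := (tendsto_nat_ceil_mul_div_atTop hu.1.le).comp
    (tendsto_natCast_atTop_atTop.comp (tendsto_add_atTop_nat 1))
  refine h.congr fun m => ?_
  simp

theorem exists_map_eq_gaussianReal_of_tendsto {Ω : Type*} [MeasurableSpace Ω] {P : Measure Ω}
    [IsProbabilityMeasure P] {Z : ℕ → Ω → ℝ} {W : Ω → ℝ} {v : ℕ → NNReal}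
    (hZ : ∀ m, P.map (Z m) = gaussianReal 0 (v m))
    (hW : ∀ ω, Tendsto (fun m => Z m ω) atTop (nhds (W ω))) :
    ∃ w : NNReal, P.map W = gaussianReal 0 w := by
  have hZm : ∀ m, AEMeasurable (Z m) P := fun m =>
    aemeasurable_of_map_neZero (by rw [hZ m]; infer_instance)
  have hWm : AEMeasurable W P := aemeasurable_of_tendsto_metrizable_ae atTop hZm (ae_of_all _ hW)
  have hprob : IsProbabilityMeasure (P.map W) := Measure.isProbabilityMeasure_map hWm
  have hlim : ∀ t : ℝ, Tendsto (fun m => ((Real.exp (-(v m / 2) * t ^ 2) : ℝ) : ℂ)) atTop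
      (nhds (charFun (P.map W) t)) := by
    intro t
    have h1 : ∀ m, ((Real.exp (-(v m / 2) * t ^ 2) : ℝ) : ℂ)
        = ∫ ω, Complex.exp (t * Z m ω * Complex.I) ∂P := by
      intro m
      have h2 := charFun_gaussianReal (μ := 0) (v := v m) t
      rw [← hZ m, charFun_apply_real, integral_map (hZm m)
        (Continuous.aestronglyMeasurable (by fun_prop))] at h2
      rw [h2]
      push_cast
      congr 1
      ring
    simp_rw [h1]
    rw [charFun_apply_real, integral_map hWm (Continuous.aestronglyMeasurable (by fun_prop))]
    refine tendsto_integral_of_dominated_convergence (fun _ => 1) (fun m => ?_)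
      (integrable_const _) (fun m => ae_of_all _ fun ω => ?_) (ae_of_all _ fun ω => ?_)
    · exact (Continuous.comp_aestronglyMeasurable
        (g := fun x : ℝ => Complex.exp (t * x * Complex.I)) (by fun_prop)
        (hZm m).aestronglyMeasurable)
    · rw [← Complex.ofReal_mul, Complex.norm_exp_ofReal_mul_I]
    · exact ((by fun_prop : Continuous fun x : ℝ =>
        Complex.exp (t * x * Complex.I)).tendsto _).comp (hW ω)
  have hre : ∀ t : ℝ, Tendsto (fun m => Real.exp (-(v m / 2) * t ^ 2)) atTop
      (nhds (charFun (P.map W) t).re) := by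
    intro t
    have h := (Complex.continuous_re.tendsto _).comp (hlim t)
    exact h.congr fun m => Complex.ofReal_re _
  have hre1 := hre 1
  simp only [one_pow, mul_one] at hre1
  set l := (charFun (P.map W) 1).re
  have hl0 : 0 ≤ l := ge_of_tendsto' hre1 fun m => (Real.exp_pos _).le
  rcases hl0.eq_or_lt with h0 | hpos
  · exfalso
    have hz : ∀ t : ℝ, t ≠ 0 → charFun (P.map W) t = 0 := by
      intro t ht
      have ht2 : 0 < t ^ 2 := by positivity
      have h3 : Tendsto (fun m => Real.exp (-(v m / 2) * t ^ 2)) atTop (nhds 0) := by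
        have h4 := ((Real.continuousAt_rpow_const l (t ^ 2) (Or.inr ht2.le)).tendsto).comp hre1
        rw [← h0, Real.zero_rpow ht2.ne'] at h4
        refine h4.congr fun m => ?_
        simp only [Function.comp]
        rw [← Real.exp_mul]
      have h5 := (Complex.continuous_ofReal.tendsto 0).comp h3
      simpa using tendsto_nhds_unique (hlim t) h5
    have hc : Tendsto (charFun (P.map W)) (nhdsWithin 0 {0}ᶜ) (nhds (charFun (P.map W) 0)) :=
      (continuous_charFun.tendsto 0).mono_left nhdsWithin_le_nhds
    have hc' : Tendsto (charFun (P.map W)) (nhdsWithin 0 {0}ᶜ) (nhds 0) :=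
      tendsto_const_nhds.congr' (eventually_nhdsWithin_of_forall fun t ht => (hz t ht).symm)
    have := tendsto_nhds_unique hc hc'
    simp at this
  · have hv : Tendsto (fun m => (v m : ℝ)) atTop (nhds (-2 * Real.log l)) := by
      have := ((Real.continuousAt_log hpos.ne').tendsto.comp hre1).const_mul (-2)
      refine this.congr fun m => ?_
      simp only [Function.comp, Real.log_exp]
      ring
    have hw : 0 ≤ -2 * Real.log l := ge_of_tendsto' hv fun m => (v m).2
    refine ⟨NNReal.mk _ hw, Measure.ext_of_charFun (funext fun t => ?_)⟩
    refine tendsto_nhds_unique (hlim t) ?_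
    rw [charFun_gaussianReal]
    have : Tendsto (fun m => Real.exp (-(v m / 2) * t ^ 2)) atTop
        (nhds (Real.exp (-((-2 * Real.log l) / 2) * t ^ 2))) :=
      (Real.continuous_exp.tendsto _).comp (((hv.div_const 2).neg).mul_const _)
    have h6 := (Complex.continuous_ofReal.tendsto _).comp this
    have h7 : Complex.exp (t * (0 : ℝ) * Complex.I
        - ((NNReal.mk (-2 * Real.log l) hw : NNReal) : ℝ) * t ^ 2 / 2)
        = ((Real.exp (-((-2 * Real.log l) / 2) * t ^ 2) : ℝ) : ℂ) := by
      rw [NNReal.coe_mk]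
      push_cast
      congr 1
      ring
    rw [h7]
    exact h6

theorem measure_le_abs_of_map_eq_gaussianReal {Ω : Type*} [MeasurableSpace Ω] {P : Measure Ω}
    [IsProbabilityMeasure P] {Z : Ω → ℝ} {v : NNReal} (hZ : P.map Z = gaussianReal 0 v)
    {σ x : ℝ} (hσ : 0 < σ) (hvar : Real.sqrt (∫ ω, Z ω ^ 2 ∂P) ≤ σ) (hx : 0 ≤ x) :
    P {ω | x ≤ |Z ω|} ≤ ENNReal.ofReal (2 * Real.exp (-x ^ 2 / (2 * σ ^ 2))) := by
  have hZm : AEMeasurable Z P := aemeasurable_of_map_neZero (by rw [hZ]; infer_instance)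
  have hv : (v : ℝ) ≤ σ ^ 2 := by
    have h1 : ∫ ω, Z ω ^ 2 ∂P = v := by
      rw [← integral_map (f := fun y : ℝ => y ^ 2) hZm
        (Continuous.aestronglyMeasurable (by fun_prop)), hZ,
        ← variance_fun_id_gaussianReal (μ := 0) (v := v), variance_eq_integral (by fun_prop)]
      simp
    rw [h1] at hvar
    exact (Real.sqrt_le_left hσ.le).1 hvar
  have hsub : HasSubgaussianMGF Z (NNReal.mk (σ ^ 2) (sq_nonneg σ)) P := by
    refine ⟨fun t => ?_, fun t => ?_⟩
    · have h2 := integrable_exp_mul_gaussianReal (μ := 0) (v := v) t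
      rw [← hZ] at h2
      exact h2.comp_aemeasurable hZm
    · rw [mgf_gaussianReal hZ]
      apply Real.exp_le_exp.2
      rw [NNReal.coe_mk]
      nlinarith [sq_nonneg t]
  have h1 := hsub.measure_ge_le hx
  have h2 := hsub.neg.measure_ge_le hx
  rw [NNReal.coe_mk] at h1 h2
  have hsubset : {ω | x ≤ |Z ω|} ⊆ {ω | x ≤ Z ω} ∪ {ω | x ≤ (-Z) ω} := fun ω hω => by
    simpa [le_abs] using hω
  rw [← ofReal_measureReal]
  refine ENNReal.ofReal_le_ofReal ?_
  calc P.real {ω | x ≤ |Z ω|} ≤ P.real ({ω | x ≤ Z ω} ∪ {ω | x ≤ (-Z) ω}) :=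
        measureReal_mono hsubset
    _ ≤ _ := measureReal_union_le _ _
    _ ≤ _ := by linarith

theorem abs_le_tsum_of_dyadic_increments {y : ℝ → ℝ} (hy : ContinuousOn y (Set.Icc 0 1))
    (hy0 : y 0 = 0) {a : ℕ → ℝ} (ha : Summable a) (ha0 : ∀ n, 0 ≤ a n)
    (hinc : ∀ n k : ℕ, k < 2 ^ (n + 1) →
      |y ((k : ℝ) / 2 ^ (n + 1) + 1 / 2 ^ (n + 1)) - y ((k : ℝ) / 2 ^ (n + 1))| ≤ a n)
    {t : ℝ} (ht : t ∈ Set.Icc (0 : ℝ) 1) : |y t| ≤ ∑' n, a n := by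
  rcases ht.1.eq_or_lt with h0 | h0
  · rw [← h0, hy0, abs_zero]
    exact tsum_nonneg ha0
  have hk : ∀ n : ℕ, ∃ k : ℕ, (k : ℝ) < 2 ^ n * t ∧ 2 ^ n * t ≤ k + 1 := by
    intro n
    have hpos : 0 < 2 ^ n * t := by positivity
    obtain ⟨k, hk⟩ := Nat.exists_eq_succ_of_ne_zero (Nat.ceil_pos.2 hpos).ne'
    have h1 := (Nat.ceil_eq_iff (by omega)).1 hk
    refine ⟨k, by simpa using h1.1, by simpa using h1.2⟩
  choose k hk1 hk2 using hk
  have hmem : ∀ n, (k n : ℝ) / 2 ^ n ∈ Set.Icc (0 : ℝ) 1 := by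
    intro n
    have : (0 : ℝ) < 2 ^ n := by positivity
    refine ⟨by positivity, ?_⟩
    rw [div_le_one this]
    nlinarith [hk1 n, ht.2]
  have hlim : Tendsto (fun n => (k n : ℝ) / 2 ^ n) atTop (nhds t) := by
    have h1 : Tendsto (fun n : ℕ => t - (1 / 2 : ℝ) ^ n) atTop (nhds (t - 0)) :=
      tendsto_const_nhds.sub
        (tendsto_pow_atTop_nhds_zero_of_lt_one (by norm_num) (by norm_num))
    rw [sub_zero] at h1
    refine tendsto_of_tendsto_of_tendsto_of_le_of_le h1 tendsto_const_nhds (fun n => ?_)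
      (fun n => ?_)
    · have : (0 : ℝ) < 2 ^ n := by positivity
      simp only [one_div, inv_pow]
      rw [le_div_iff₀ this, sub_mul, inv_mul_cancel₀ this.ne']
      linarith [hk2 n]
    · have : (0 : ℝ) < 2 ^ n := by positivity
      simp only
      rw [div_le_iff₀ this]
      linarith [hk1 n]
  have hylim : Tendsto (fun n => y ((k n : ℝ) / 2 ^ n)) atTop (nhds (y t)) :=
    (hy t ht).tendsto.comp
      (tendsto_nhdsWithin_iff.2 ⟨hlim, Eventually.of_forall hmem⟩)
  have hstep : ∀ n, dist (y ((k n : ℝ) / 2 ^ n)) (y ((k n.succ : ℝ) / 2 ^ n.succ)) ≤ a n := by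
    intro n
    have hp : (0 : ℝ) < 2 ^ n := by positivity
    have e1 := hk1 n
    have e2 := hk2 n
    have e3 := hk1 (n + 1)
    have e4 := hk2 (n + 1)
    rw [pow_succ] at e3 e4
    have c1 : k (n + 1) < 2 * k n + 2 := by
      have : (k (n + 1) : ℝ) < 2 * k n + 2 := by linarith
      exact_mod_cast this
    have c2 : 2 * k n < k (n + 1) + 1 := by
      have : (2 * k n : ℝ) < k (n + 1) + 1 := by linarith
      exact_mod_cast this
    have hdiv : (k n : ℝ) / 2 ^ n = ((2 * k n : ℕ) : ℝ) / 2 ^ (n + 1) := by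
      push_cast
      rw [pow_succ]
      field_simp
    have c3 : k (n + 1) < 2 ^ (n + 1) := by
      have : (k (n + 1) : ℝ) < 2 ^ (n + 1) := by
        rw [pow_succ]
        nlinarith [ht.2]
      exact_mod_cast this
    rw [Nat.succ_eq_add_one, hdiv]
    have hcases : k (n + 1) = 2 * k n ∨ k (n + 1) = 2 * k n + 1 := by omega
    rcases hcases with h | h
    · rw [h, dist_self]
      exact ha0 n
    · have := hinc n (2 * k n) (by omega)
      rw [dist_comm, Real.dist_eq, h]
      convert this using 4
      push_cast
      ring
  have h := dist_le_tsum_of_dist_le_of_tendsto₀ a hstep ha hylim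
  have hk0 : k 0 = 0 := by
    have : (k 0 : ℝ) < 1 := by linarith [ht.2, hk1 0]
    have : k 0 < 1 := by exact_mod_cast this
    omega
  simpa [hk0, hy0, Real.dist_eq] using h

theorem summable_two_pow_mul_exp_neg {B q : ℝ} (hB : 0 < B) (hq : 1 < q) :
    Summable fun n : ℕ => 2 ^ n * Real.exp (-(B * q ^ n)) := by
  refine summable_of_ratio_test_tendsto_lt_one zero_lt_one
    (Eventually.of_forall fun n => by positivity) ?_
  have h1 : Tendsto (fun n : ℕ => (B * (q - 1)) * q ^ n) atTop atTop :=
    (tendsto_pow_atTop_atTop_of_one_lt hq).const_mul_atTop (by nlinarith)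
  have h2 := (Real.tendsto_exp_neg_atTop_nhds_zero.comp h1).const_mul 2
  rw [mul_zero] at h2
  refine h2.congr fun n => ?_
  rw [Real.norm_of_nonneg (by positivity), Real.norm_of_nonneg (by positivity),
    eq_div_iff (by positivity), pow_succ, pow_succ]
  simp only [Function.comp]
  rw [show -(B * (q ^ n * q)) = -(B * (q - 1) * q ^ n) + -(B * q ^ n) by ring, Real.exp_add]
  ring

theorem intervalIntegrable_rpow_sub_one {θ : ℝ} (hθ : 0 < θ) (a b : ℝ) :
    IntervalIntegrable (fun v : ℝ => v ^ (θ - 1)) volume a b :=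
  intervalIntegral.intervalIntegrable_rpow' (by linarith)

section FracInt

variable {Ω : Type*} {θ : ℝ} {X : ℝ → Ω → ℝ}

theorem fracInt_eq_integral_clamp (hθ : 0 < θ)
    {ω : Ω} (hcont : Continuous fun u : ℝ => X (max 0 (min 1 u)) ω) (hX0 : X 0 ω = 0)
    {t : ℝ} (ht : t ∈ Set.Icc (0 : ℝ) 1) :
    fracInt θ X t ω
      = (Real.Gamma θ)⁻¹ * ∫ v in (0 : ℝ)..1, v ^ (θ - 1) * X (max 0 (min 1 (t - v))) ω := by
  have hint : ∀ a b : ℝ, IntervalIntegrable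
      (fun v => v ^ (θ - 1) * X (max 0 (min 1 (t - v))) ω) volume a b := fun a b =>
    (intervalIntegrable_rpow_sub_one hθ a b).mul_continuousOn
      (hcont.comp (continuous_const.sub continuous_id)).continuousOn
  rw [fracInt, ← intervalIntegral.integral_add_adjacent_intervals (hint 0 t) (hint t 1)]
  have h1 : ∫ v in t..1, v ^ (θ - 1) * X (max 0 (min 1 (t - v))) ω = 0 := by
    rw [intervalIntegral.integral_congr (g := fun _ => 0), intervalIntegral.integral_zero]
    intro v hv
    rw [Set.uIcc_of_le ht.2] at hv
    have : max 0 (min 1 (t - v)) = 0 := max_eq_left ((min_le_right _ _).trans (by linarith [hv.1]))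
    simp [this, hX0]
  have h2 := intervalIntegral.integral_comp_sub_left (a := 0) (b := t)
    (fun v => v ^ (θ - 1) * X (max 0 (min 1 (t - v))) ω) t
  rw [sub_self, sub_zero] at h2
  rw [h1, add_zero, ← h2]
  congr 1
  refine intervalIntegral.integral_congr fun u hu => ?_
  rw [Set.uIcc_of_le ht.1] at hu
  have : max 0 (min 1 (t - (t - u))) = u := by
    rw [sub_sub_cancel, min_eq_right (hu.2.trans ht.2), max_eq_right hu.1]
  simp only [this]

theorem continuous_clamp {ω : Ω} (hcont : ContinuousOn (fun t => X t ω) (Set.Icc 0 1)) :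
    Continuous fun u : ℝ => X (max 0 (min 1 u)) ω :=
  hcont.comp_continuous (f := fun u : ℝ => max 0 (min 1 u)) (by fun_prop) fun u =>
    ⟨le_max_left _ _, max_le zero_le_one (min_le_left _ _)⟩

theorem continuousOn_fracInt (hθ : 0 < θ) {ω : Ω}
    (hcont : ContinuousOn (fun t => X t ω) (Set.Icc 0 1)) (hX0 : X 0 ω = 0) :
    ContinuousOn (fun t => fracInt θ X t ω) (Set.Icc 0 1) := by
  have hc := continuous_clamp hcont
  obtain ⟨C, hC⟩ := isCompact_Icc.exists_bound_of_continuousOn hcont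
  suffices h : Continuous fun t : ℝ =>
      (Real.Gamma θ)⁻¹ * ∫ v in (0 : ℝ)..1, v ^ (θ - 1) * X (max 0 (min 1 (t - v))) ω from
    h.continuousOn.congr fun t ht => fracInt_eq_integral_clamp hθ hc hX0 ht
  refine continuous_const.mul (intervalIntegral.continuous_of_dominated_interval
    (bound := fun v => ‖v ^ (θ - 1)‖ * C) (fun t => ?_) (fun t => ae_of_all _ fun v _ => ?_)
    ((intervalIntegrable_rpow_sub_one hθ 0 1).norm.mul_const C) (ae_of_all _ fun v _ => ?_))
  · exact (intervalIntegrable_rpow_sub_one hθ 0 1).aestronglyMeasurable_restrict_uIoc.mul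
      (hc.comp (continuous_const.sub continuous_id)).aestronglyMeasurable
  · rw [norm_mul]
    exact mul_le_mul_of_nonneg_left
      (hC _ ⟨le_max_left _ _, max_le zero_le_one (min_le_left _ _)⟩) (norm_nonneg _)
  · exact continuous_const.mul (hc.comp (continuous_id.sub continuous_const))

variable [MeasurableSpace Ω] {P : Measure Ω}

theorem IsCenteredGaussianProcess.map_sum (hGauss : IsCenteredGaussianProcess P X)
    {ι : Type*} [Fintype ι] (t c : ι → ℝ) :
    ∃ v : NNReal, P.map (fun ω => ∑ i, c i * X (t i) ω) = gaussianReal 0 v := by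
  obtain ⟨v, hv⟩ := hGauss (Fintype.card ι) (t ∘ (Fintype.equivFin ι).symm)
    (c ∘ (Fintype.equivFin ι).symm)
  refine ⟨v, ?_⟩
  rw [← hv]
  congr 1
  funext ω
  exact ((Fintype.equivFin ι).symm.sum_comp fun i => c i * X (t i) ω).symm

theorem IsCenteredGaussianProcess.fracInt_sub [IsProbabilityMeasure P]
    (hGauss : IsCenteredGaussianProcess P X) (hθ : 0 < θ)
    (hcont : ∀ ω, ContinuousOn (fun t => X t ω) (Set.Icc 0 1)) (hX0 : ∀ ω, X 0 ω = 0)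
    {s t : ℝ} (hs : s ∈ Set.Icc (0 : ℝ) 1) (ht : t ∈ Set.Icc (0 : ℝ) 1) :
    ∃ v : NNReal, P.map (fun ω => fracInt θ X t ω - fracInt θ X s ω) = gaussianReal 0 v := by
  have hk : IntervalIntegrable (fun v : ℝ => (Real.Gamma θ)⁻¹ * v ^ (θ - 1)) volume 0 1 :=
    (intervalIntegrable_rpow_sub_one hθ 0 1).const_mul _
  let w : ℕ → ℕ → ℝ := fun m j =>
    ∫ u in ((j : ℝ) / (m + 1))..((j + 1 : ℝ) / (m + 1)), (Real.Gamma θ)⁻¹ * u ^ (θ - 1)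
  let p : ℝ → ℕ → ℕ → ℝ := fun r m j => max 0 (min 1 (r - (j + 1) / (m + 1)))
  have hlim : ∀ r ∈ Set.Icc (0 : ℝ) 1, ∀ ω, Tendsto
      (fun m : ℕ => ∑ j : Fin (m + 1), w m j * X (p r m j) ω) atTop
      (nhds (fracInt θ X r ω)) := by
    intro r hr ω
    have hc := continuous_clamp (hcont ω)
    have h := tendsto_sum_integral_mul hk (g := fun v => X (max 0 (min 1 (r - v))) ω)
      (hc.comp (continuous_const.sub continuous_id))
    rw [fracInt_eq_integral_clamp hθ hc (hX0 ω) hr, ← intervalIntegral.integral_const_mul]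
    simp only [mul_assoc] at h
    refine h.congr fun m => ?_
    rw [← Fin.sum_univ_eq_sum_range (fun j : ℕ => w m j * X (p r m j) ω)]
  have hG : ∀ m : ℕ, ∃ v : NNReal, P.map (fun ω => ∑ j : Fin (m + 1), w m j * X (p t m j) ω
      - ∑ j : Fin (m + 1), w m j * X (p s m j) ω) = gaussianReal 0 v := by
    intro m
    obtain ⟨v, hv⟩ := hGauss.map_sum (ι := Fin (m + 1) ⊕ Fin (m + 1))
      (Sum.elim (fun j => p t m j) fun j => p s m j)
      (Sum.elim (fun j => w m j) fun j => -w m j)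
    refine ⟨v, ?_⟩
    rw [← hv]
    congr 1
    funext ω
    simp [Fintype.sum_sum_type, sub_eq_add_neg]
  choose v hv using hG
  exact exists_map_eq_gaussianReal_of_tendsto hv fun ω => (hlim t ht ω).sub (hlim s hs ω)

end FracInt

theorem gaussian_exponent_le {B r u A c δ : ℝ} (hB : B = A ^ 2 / 4) (hc : 0 < c)
    (hr : r = (δ / c) ^ 2) (hr1 : 1 ≤ r) (hu0 : 0 < u) (hu1 : u ≤ 1) :
    -(δ * A * u) ^ 2 / (2 * (c * u ^ 2) ^ 2) ≤ -(B * (u ^ 2)⁻¹) + -(B * r) := by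
  have hz : 1 ≤ (u ^ 2)⁻¹ := (one_le_inv₀ (by positivity)).2 (pow_le_one₀ hu0.le hu1)
  have h : -(δ * A * u) ^ 2 / (2 * (c * u ^ 2) ^ 2) = -(2 * B * r * (u ^ 2)⁻¹) := by
    rw [hB, hr]
    field_simp
    ring
  have hB0 : 0 ≤ B := by rw [hB]; positivity
  rw [h]
  generalize (u ^ 2)⁻¹ = z at hz
  nlinarith [mul_nonneg hB0 (mul_nonneg (zero_le_one.trans hr1) (sub_nonneg.2 hz)),
    mul_nonneg hB0 (mul_nonneg (zero_le_one.trans hz) (sub_nonneg.2 hr1))]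

/-- Maximal inequality for the fractional integral of a Gaussian process:
the constant `c` is independent of `c_Y` and `δ`. -/
theorem fracInt_maximal_inequality
    {Ω : Type*} [MeasurableSpace Ω] (P : Measure Ω) [IsProbabilityMeasure P]
    (X : ℝ → Ω → ℝ) (θ η : ℝ) (hθ : 0 < θ) (hη : 0 < η)
    (hGauss : IsCenteredGaussianProcess P X)
    (hcont : ∀ ω, ContinuousOn (fun t => X t ω) (Set.Icc 0 1))
    (hX0 : ∀ ω, X 0 ω = 0) :
    ∃ c : ℝ, 0 < c ∧ ∀ c_Y : ℝ, 0 < c_Y →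
      (∀ s h : ℝ, 0 < h → h < 1 → 0 ≤ s → s + h ≤ 1 →
        Real.sqrt (∫ ω, (fracInt θ X (s + h) ω - fracInt θ X s ω) ^ 2 ∂P) ≤ c_Y * h ^ η) →
      ∀ δ : ℝ, c_Y < δ →
        P {ω | δ ≤ ⨆ s : Set.Icc (0:ℝ) 1, |fracInt θ X s.1 ω|} ≤
          ENNReal.ofReal ((1 / c) * Real.exp (-c * (δ / c_Y) ^ 2)) := by
  obtain ⟨p, hp0, hp1, hp⟩ : ∃ p : ℝ, 0 < p ∧ p < 1 ∧ p ^ 2 = (1 / 2 : ℝ) ^ η := by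
    refine ⟨(1 / 2 : ℝ) ^ (η / 2), by positivity,
      Real.rpow_lt_one (by norm_num) (by norm_num) (by positivity), ?_⟩
    rw [← Real.rpow_natCast, ← Real.rpow_mul (by norm_num)]
    norm_num
  have hA : 0 < 1 - p := sub_pos.2 hp1
  obtain ⟨B, hB⟩ : ∃ B, B = (1 - p) ^ 2 / 4 := ⟨_, rfl⟩
  have hB0 : 0 < B := by rw [hB]; positivity
  have hQ : 1 < (p ^ 2)⁻¹ := (one_lt_inv₀ (by positivity)).2 (pow_lt_one₀ hp0.le hp1 two_ne_zero)
  have hS : Summable fun n : ℕ =>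
      2 * (2 ^ (n + 1) * Real.exp (-(B * (p ^ 2)⁻¹ ^ (n + 1)))) :=
    ((summable_nat_add_iff 1).2 (summable_two_pow_mul_exp_neg hB0 hQ)).mul_left 2
  obtain ⟨S, hSdef⟩ : ∃ S, S = ∑' n : ℕ,
      2 * (2 ^ (n + 1) * Real.exp (-(B * (p ^ 2)⁻¹ ^ (n + 1)))) := ⟨_, rfl⟩
  have hS0 : 0 ≤ S := by rw [hSdef]; exact tsum_nonneg fun n => by positivity
  refine ⟨min B (1 / (S + 1)), lt_min hB0 (by positivity), ?_⟩
  intro c_Y hc hvar δ hδ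
  obtain ⟨r, hr⟩ : ∃ r, r = (δ / c_Y) ^ 2 := ⟨_, rfl⟩
  have hr1 : 1 ≤ r := by
    rw [hr]
    exact one_le_pow₀ ((one_le_div hc).2 hδ.le)
  have hδ0 : 0 < δ := hc.trans hδ
  let E : ℕ → ℕ → Set Ω := fun n k => {ω | δ * (1 - p) * p ^ (n + 1) ≤
    |fracInt θ X ((k : ℝ) / 2 ^ (n + 1) + 1 / 2 ^ (n + 1)) ω
      - fracInt θ X ((k : ℝ) / 2 ^ (n + 1)) ω|}
  have hsub : {ω | δ ≤ ⨆ s : Set.Icc (0:ℝ) 1, |fracInt θ X s.1 ω|} ⊆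
      ⋃ n : ℕ, ⋃ k ∈ Finset.range (2 ^ (n + 1)), E n k := by
    intro ω hω
    by_contra hcon
    simp only [Set.mem_iUnion, not_exists, E, Set.mem_ofPred_eq, not_le, Finset.mem_range] at hcon
    have hgeo : HasSum (fun n : ℕ => δ * (1 - p) * p ^ (n + 1)) (δ * p) := by
      have h := (hasSum_geometric_of_lt_one hp0.le hp1).mul_left (δ * (1 - p) * p)
      rw [show δ * (1 - p) * p * (1 - p)⁻¹ = δ * p by field_simp] at h
      exact h.congr_fun fun n => by ring
    have hle : ∀ s : Set.Icc (0 : ℝ) 1, |fracInt θ X s.1 ω| ≤ δ * p := fun s => by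
      rw [← hgeo.tsum_eq]
      exact abs_le_tsum_of_dyadic_increments (continuousOn_fracInt hθ (hcont ω) (hX0 ω))
        (by simp [fracInt]) hgeo.summable (fun n => by positivity)
        (fun n k hk => (hcon n k hk).le) s.2
    have : δ ≤ δ * p := le_trans hω (ciSup_le hle)
    nlinarith
  have hE : ∀ n k : ℕ, k ∈ Finset.range (2 ^ (n + 1)) → P (E n k) ≤
      ENNReal.ofReal (2 * Real.exp (-(B * (p ^ 2)⁻¹ ^ (n + 1))) * Real.exp (-(B * r))) := by
    intro n k hk
    have hN : (0 : ℝ) < 2 ^ (n + 1) := by positivity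
    have hk1 : (k : ℝ) + 1 ≤ 2 ^ (n + 1) := by
      exact_mod_cast Finset.mem_range.1 hk
    have hs0 : (0 : ℝ) ≤ (k : ℝ) / 2 ^ (n + 1) := by positivity
    have hs1 : (k : ℝ) / 2 ^ (n + 1) + 1 / 2 ^ (n + 1) ≤ 1 := by
      rw [← add_div, div_le_one hN]
      exact hk1
    have hh0 : (0 : ℝ) < 1 / 2 ^ (n + 1) := by positivity
    obtain ⟨v, hv⟩ := hGauss.fracInt_sub hθ hcont hX0 (s := (k : ℝ) / 2 ^ (n + 1))
      (t := (k : ℝ) / 2 ^ (n + 1) + 1 / 2 ^ (n + 1)) ⟨hs0, by linarith⟩ ⟨by linarith, hs1⟩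
    have hsd := hvar _ _ hh0
      ((div_lt_one hN).2 (one_lt_pow₀ one_lt_two (Nat.succ_ne_zero n))) hs0 hs1
    have hpow : (1 / 2 ^ (n + 1) : ℝ) ^ η = (p ^ (n + 1)) ^ 2 := by
      rw [← one_div_pow, ← Real.rpow_natCast, ← Real.rpow_mul (by norm_num), mul_comm,
        Real.rpow_mul (by norm_num), ← hp, Real.rpow_natCast, pow_right_comm]
    rw [hpow] at hsd
    refine (measure_le_abs_of_map_eq_gaussianReal hv (by positivity) hsd
      (by positivity)).trans (ENNReal.ofReal_le_ofReal ?_)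
    rw [mul_assoc 2, ← Real.exp_add, inv_pow, pow_right_comm p 2]
    gcongr
    exact gaussian_exponent_le hB hc hr hr1 (by positivity) (pow_le_one₀ hp0.le hp1.le)
  have hmono : S * Real.exp (-(B * r)) ≤
      1 / min B (1 / (S + 1)) * Real.exp (-min B (1 / (S + 1)) * (δ / c_Y) ^ 2) := by
    rw [← hr]
    have hcpos : 0 < min B (1 / (S + 1)) := lt_min hB0 (by positivity)
    refine mul_le_mul ?_ (Real.exp_le_exp.2 ?_) (Real.exp_pos _).le (by positivity)
    · have h : S + 1 ≤ 1 / min B (1 / (S + 1)) := by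
        rw [le_div_comm₀ (by positivity) hcpos]
        exact min_le_right _ _
      linarith
    · nlinarith [min_le_left B (1 / (S + 1))]
  refine le_trans ?_ (ENNReal.ofReal_le_ofReal hmono)
  calc P {ω | δ ≤ ⨆ s : Set.Icc (0:ℝ) 1, |fracInt θ X s.1 ω|}
      ≤ P (⋃ n : ℕ, ⋃ k ∈ Finset.range (2 ^ (n + 1)), E n k) := measure_mono hsub
    _ ≤ ∑' n : ℕ, P (⋃ k ∈ Finset.range (2 ^ (n + 1)), E n k) := measure_iUnion_le _
    _ ≤ ∑' n : ℕ, ENNReal.ofReal (2 * (2 ^ (n + 1) *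
          Real.exp (-(B * (p ^ 2)⁻¹ ^ (n + 1)))) * Real.exp (-(B * r))) := by
        refine ENNReal.tsum_le_tsum fun n => (measure_biUnion_finset_le _ _).trans
          ((Finset.sum_le_sum (hE n)).trans_eq ?_)
        rw [Finset.sum_const, Finset.card_range, ← ENNReal.ofReal_nsmul, nsmul_eq_mul]
        congr 1
        push_cast
        ring
    _ = ENNReal.ofReal (S * Real.exp (-(B * r))) := by
        rw [← ENNReal.ofReal_tsum_of_nonneg (fun n => by positivity) (hS.mul_right _),
          tsum_mul_right, hSdef]
end

section
/- (Zero-one law at 0.) There exists a constant κ′₁ ∈ [0, ∞] (possibly 0 or ∞) such that, almost surely, liminf_{t → 0+} [ sup_{0 ≤ s ≤ t} |Y(s)| ] · (ln ln(1/t))^{β} / t^{H+θ} = κ′₁. -/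
open MeasureTheory ProbabilityTheory Real Set Filter

/-- The covariance function of the generalized fractional Brownian motion:
`E[X s X t] = ∫_ℝ ((s−u)₊^α − (−u)₊^α)((t−u)₊^α − (−u)₊^α)|u|^{−γ} du`. -/
noncomputable def gfbmCov (α γ s t : ℝ) : ℝ :=
  ∫ u : ℝ, ((max (s - u) 0) ^ α - (max (-u) 0) ^ α) *
    ((max (t - u) 0) ^ α - (max (-u) 0) ^ α) * |u| ^ (-γ)

/-- `X` is a generalized fractional Brownian motion with parameters `(α, γ)` under `P`. -/
def IsGFBM {Ω : Type*} [MeasurableSpace Ω] (P : Measure Ω) (α γ : ℝ)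
    (X : ℝ → Ω → ℝ) : Prop :=
  IsCenteredGaussianProcess P X ∧
  (∀ ω, ContinuousOn (fun t => X t ω) (Set.Ici 0)) ∧
  (∀ ω, X 0 ω = 0) ∧
  (∀ s t : ℝ, 0 ≤ s → 0 ≤ t → ∫ ω, X s ω * X t ω ∂P = gfbmCov α γ s t)

/-- The running maximum `M(t) = sup_{0 ≤ s ≤ t} |Y(s)|`. -/
noncomputable def runSup {Ω : Type*} (Y : ℝ → Ω → ℝ) (t : ℝ) (ω : Ω) : ℝ :=
  ⨆ s : Set.Icc (0:ℝ) t, |Y s.1 ω|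

/-- The small ball function `φ(ε) = P(M(1) ≤ ε)`. -/
noncomputable def smallBall {Ω : Type*} [MeasurableSpace Ω] (P : Measure Ω)
    (Y : ℝ → Ω → ℝ) (ε : ℝ) : ℝ :=
  (P {ω | runSup Y 1 ω ≤ ε}).toReal


/-- The square-integrable kernel whose Gram function is the covariance of the GFBM. -/
noncomputable def gfbmKernel (α γ s u : ℝ) : ℝ :=
  ((max (s - u) 0) ^ α - (max (-u) 0) ^ α) * |u| ^ (-γ / 2)

theorem measurable_gfbmKernel (α γ s : ℝ) : Measurable (gfbmKernel α γ s) := by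
  unfold gfbmKernel; fun_prop

theorem gfbmCov_eq_integral_kernel (α γ s t : ℝ) :
    gfbmCov α γ s t = ∫ u : ℝ, gfbmKernel α γ s u * gfbmKernel α γ t u := by
  unfold gfbmCov gfbmKernel
  congr 1; ext u
  have h : |u| ^ (-γ) = |u| ^ (-γ / 2) * |u| ^ (-γ / 2) := by
    rw [← sq, ← Real.rpow_natCast, ← Real.rpow_mul (abs_nonneg u)]
    congr 1; push_cast; ring
  rw [h]; ring

theorem gfbmKernel_smul (α γ s v : ℝ) {a : ℝ} (ha : 0 < a) :
    gfbmKernel α γ (a * s) (a * v) = a ^ (α - γ / 2) * gfbmKernel α γ s v := by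
  unfold gfbmKernel
  have h1 : ∀ x : ℝ, max (a * x) 0 = a * max x 0 := fun x => by
    rw [mul_max_of_nonneg _ _ ha.le, mul_zero]
  rw [← mul_sub, ← mul_neg, h1, h1, Real.mul_rpow ha.le (le_max_right _ _),
    Real.mul_rpow ha.le (le_max_right _ _), abs_mul, abs_of_pos ha,
    Real.mul_rpow ha.le (abs_nonneg _), sub_eq_add_neg α, Real.rpow_add ha, ← neg_div]
  ring

/-- Self-similarity of the GFBM covariance. -/
theorem gfbmCov_smul_smul (α γ s t : ℝ) {a : ℝ} (ha : 0 < a) :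
    gfbmCov α γ (a * s) (a * t) = a ^ (2 * (α - γ / 2 + 1 / 2)) * gfbmCov α γ s t := by
  have h := Measure.integral_comp_mul_left
    (fun u => gfbmKernel α γ (a * s) u * gfbmKernel α γ (a * t) u) a
  simp only [gfbmKernel_smul α γ _ _ ha, smul_eq_mul, abs_of_pos (inv_pos.2 ha)] at h
  rw [← gfbmCov_eq_integral_kernel] at h
  have h2 : gfbmCov α γ (a * s) (a * t) = a * (a⁻¹ * gfbmCov α γ (a * s) (a * t)) := by
    field_simp
  rw [h2, ← h, gfbmCov_eq_integral_kernel, ← integral_const_mul, ← integral_const_mul]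
  congr 1; ext u
  have h3 : 2 * (α - γ / 2 + 1 / 2) = (α - γ / 2) + (α - γ / 2) + 1 := by ring
  rw [h3, Real.rpow_add ha, Real.rpow_add ha, Real.rpow_one]
  ring

/-- Dilations in `L²(ℝ)` converge weakly to zero. -/
theorem tendsto_integral_dilation_mul {h g : ℝ → ℝ} (hm : Measurable h) (gm : Measurable g)
    (hi : Integrable (fun u => h u ^ 2)) (gi : Integrable (fun u => g u ^ 2)) :
    Tendsto (fun a : ℝ => ∫ v, a ^ (1 / 2 : ℝ) * (h v * g (a * v))) (nhdsWithin 0 (Ioi 0))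
      (nhds 0) := by
  have hG : Tendsto (fun a : ℝ => ∫ u, {u : ℝ | |u| ≤ √a}.indicator (fun u => g u ^ 2) u)
      (nhdsWithin 0 (Ioi 0)) (nhds (∫ _ : ℝ, (0 : ℝ))) := by
    refine tendsto_integral_filter_of_dominated_convergence (fun u => g u ^ 2) ?_ ?_ gi ?_
    · refine Eventually.of_forall fun a => ?_
      refine (Measurable.indicator (by fun_prop) ?_).aestronglyMeasurable
      exact measurableSet_le (by fun_prop) (by fun_prop)
    · refine Eventually.of_forall fun a => Eventually.of_forall fun u => ?_
      rw [Real.norm_eq_abs, abs_of_nonneg (indicator_nonneg (fun _ _ => sq_nonneg _) _)]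
      exact indicator_le_self' (fun _ _ => sq_nonneg _) _
    · filter_upwards [compl_mem_ae_iff.2 (measure_singleton (0 : ℝ))] with u hu
      refine tendsto_const_nhds.congr' ?_
      have h0 : Tendsto (fun a : ℝ => √a) (nhdsWithin 0 (Ioi 0)) (nhds 0) := by
        have := (Real.continuous_sqrt.tendsto 0).mono_left (nhdsWithin_le_nhds (s := Ioi 0))
        simpa using this
      filter_upwards [h0.eventually (gt_mem_nhds (abs_pos.2 hu))] with a ha
      rw [indicator_of_notMem]
      simpa using ha
  have hT : Tendsto (fun a : ℝ => ∫ u, {u : ℝ | 1 < |u| * √a}.indicator (fun u => h u ^ 2) u)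
      (nhdsWithin 0 (Ioi 0)) (nhds (∫ _ : ℝ, (0 : ℝ))) := by
    refine tendsto_integral_filter_of_dominated_convergence (fun u => h u ^ 2) ?_ ?_ hi ?_
    · refine Eventually.of_forall fun a => ?_
      refine (Measurable.indicator (by fun_prop) ?_).aestronglyMeasurable
      exact measurableSet_lt (by fun_prop) (by fun_prop)
    · refine Eventually.of_forall fun a => Eventually.of_forall fun u => ?_
      rw [Real.norm_eq_abs, abs_of_nonneg (indicator_nonneg (fun _ _ => sq_nonneg _) _)]
      exact indicator_le_self' (fun _ _ => sq_nonneg _) _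
    · refine Eventually.of_forall fun u => ?_
      refine tendsto_const_nhds.congr' ?_
      have h0 : Tendsto (fun a : ℝ => |u| * √a) (nhdsWithin 0 (Ioi 0)) (nhds 0) := by
        have := ((Real.continuous_sqrt.const_mul |u|).tendsto 0).mono_left
          (nhdsWithin_le_nhds (s := Ioi 0))
        simpa using this
      filter_upwards [h0.eventually (gt_mem_nhds one_pos)] with a ha
      rw [indicator_of_notMem]
      simpa using ha.le
  simp only [integral_zero] at hG hT
  set A := ∫ u, h u ^ 2
  set B := ∫ u, g u ^ 2
  have hA : 0 ≤ A := integral_nonneg fun _ => sq_nonneg _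
  have hB : 0 ≤ B := integral_nonneg fun _ => sq_nonneg _
  have key : ∀ ε > 0, ∀ a > 0, |∫ v, a ^ (1 / 2 : ℝ) * (h v * g (a * v))| ≤
      ε * (A + B) + ε⁻¹ * ((∫ u, {u : ℝ | |u| ≤ √a}.indicator (fun u => g u ^ 2) u) +
        ∫ u, {u : ℝ | 1 < |u| * √a}.indicator (fun u => h u ^ 2) u) := by
    intro ε hε a ha
    have hsc : ∀ f : ℝ → ℝ, ∫ v, a * f (a * v) = ∫ u, f u := fun f => by
      rw [integral_const_mul, Measure.integral_comp_mul_left, abs_of_pos (inv_pos.2 ha),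
        smul_eq_mul, mul_inv_cancel_left₀ ha.ne']
    have hsi : ∀ f : ℝ → ℝ, Integrable f → Integrable (fun v => a * f (a * v)) := fun f hf =>
      (hf.comp_mul_left' ha.ne').const_mul a
    have i1 := hsi _ gi
    have hs1 : MeasurableSet {u : ℝ | |u| ≤ √a} := measurableSet_le (by fun_prop) (by fun_prop)
    have hs2 : MeasurableSet {u : ℝ | 1 < |u| * √a} :=
      measurableSet_lt (by fun_prop) (by fun_prop)
    have i2 := hsi _ (gi.indicator hs1)
    have i3 := hi.indicator hs2
    have j1 : Integrable (fun v => ε * (h v ^ 2 + a * g (a * v) ^ 2)) := (hi.add i1).const_mul _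
    have j2 : Integrable (fun v =>
        ε⁻¹ * (a * {u : ℝ | |u| ≤ √a}.indicator (fun u => g u ^ 2) (a * v) +
          {u : ℝ | 1 < |u| * √a}.indicator (fun u => h u ^ 2) v)) := (i2.add i3).const_mul _
    rw [← hsc (fun u => {u : ℝ | |u| ≤ √a}.indicator (fun u => g u ^ 2) u),
      show B = _ from (hsc (fun u => g u ^ 2)).symm, ← integral_add hi i1, ← integral_add i2 i3,
      ← integral_const_mul, ← integral_const_mul,
      ← integral_add j1 j2]
    rw [← Real.norm_eq_abs]
    refine norm_integral_le_of_norm_le (j1.add j2) (Eventually.of_forall fun v => ?_)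
    simp only [Real.norm_eq_abs]
    rw [← Real.sqrt_eq_rpow, abs_mul, abs_mul, abs_of_nonneg (Real.sqrt_nonneg a)]
    have hsq : √a ^ 2 = a := Real.sq_sqrt ha.le
    have hsp : 0 < √a := Real.sqrt_pos.2 ha
    have hgg : a * g (a * v) ^ 2 = (√a * |g (a * v)|) ^ 2 := by rw [mul_pow, hsq, sq_abs]
    have hhh : h v ^ 2 = |h v| ^ 2 := (sq_abs _).symm
    set x := |h v|
    set y := √a * |g (a * v)|
    have hx : 0 ≤ x := abs_nonneg _
    have hy : 0 ≤ y := by positivity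
    have e1 : √a * (x * |g (a * v)|) = x * y := by ring
    rw [e1]
    by_cases hv : |a * v| ≤ √a
    · have m1 : a * v ∈ {u : ℝ | |u| ≤ √a} := hv
      rw [indicator_of_mem m1]
      have n2 : 0 ≤ {u : ℝ | 1 < |u| * √a}.indicator (fun u => h u ^ 2) v :=
        indicator_nonneg (fun _ _ => sq_nonneg _) _
      rw [hgg, hhh]
      have e2 : x * y ≤ ε * x ^ 2 + ε⁻¹ * y ^ 2 := by
        have h5 : (√ε * x) * (√ε⁻¹ * y) = x * y := by
          rw [Real.sqrt_inv]
          have := (Real.sqrt_pos.2 hε).ne'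
          field_simp
        have h6 := two_mul_le_add_sq (√ε * x) (√ε⁻¹ * y)
        rw [mul_pow, mul_pow, Real.sq_sqrt hε.le, Real.sq_sqrt (inv_pos.2 hε).le, mul_assoc 2, h5]
          at h6
        nlinarith [mul_nonneg hx hy]
      have := mul_nonneg (inv_pos.2 hε).le n2
      nlinarith [mul_nonneg hε.le (sq_nonneg y)]
    · have m1 : a * v ∉ {u : ℝ | |u| ≤ √a} := hv
      have m2 : v ∈ {u : ℝ | 1 < |u| * √a} := by
        simp only [mem_ofPred_eq]
        rw [not_le, abs_mul, abs_of_pos ha] at hv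
        nlinarith
      rw [indicator_of_notMem m1, indicator_of_mem m2, hgg, hhh]
      have e2 : x * y ≤ ε * y ^ 2 + ε⁻¹ * x ^ 2 := by
        have h5 : (√ε⁻¹ * x) * (√ε * y) = x * y := by
          rw [Real.sqrt_inv]
          have := (Real.sqrt_pos.2 hε).ne'
          field_simp
        have h6 := two_mul_le_add_sq (√ε⁻¹ * x) (√ε * y)
        rw [mul_pow, mul_pow, Real.sq_sqrt hε.le, Real.sq_sqrt (inv_pos.2 hε).le, mul_assoc 2, h5]
          at h6
        nlinarith [mul_nonneg hx hy]
      nlinarith [mul_nonneg hε.le (sq_nonneg x)]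
  rw [Metric.tendsto_nhds]
  intro δ hδ
  set ε := δ / (2 * (A + B + 1))
  have hε : 0 < ε := by positivity
  have hεAB : ε * (A + B) < δ / 2 + δ / 4 := by
    have : ε * (A + B + 1) = δ / 2 := by
      simp only [ε]; field_simp
    nlinarith
  have hlim := (hG.add hT).const_mul ε⁻¹
  simp only [add_zero, mul_zero] at hlim
  filter_upwards [hlim.eventually (gt_mem_nhds (show 0 < δ / 4 by positivity)),
    self_mem_nhdsWithin] with a h1 ha
  rw [Real.dist_eq, sub_zero]
  have := key ε hε a ha
  linarith

/-- Asymptotic decorrelation of the rescaled GFBM under large dilations. -/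
theorem tendsto_gfbmCov_dilation {α γ s t : ℝ} (hs : gfbmCov α γ s s ≠ 0)
    (ht : gfbmCov α γ t t ≠ 0) :
    Tendsto (fun a : ℝ => a ^ (-(α - γ / 2 + 1 / 2)) * gfbmCov α γ (a * s) t)
      (nhdsWithin 0 (Ioi 0)) (nhds 0) := by
  have hint : ∀ r, gfbmCov α γ r r ≠ 0 → Integrable (fun u => gfbmKernel α γ r u ^ 2) := by
    intro r hr
    by_contra h
    refine hr ?_
    rw [gfbmCov_eq_integral_kernel, integral_undef]
    simpa only [sq] using h
  refine (tendsto_integral_dilation_mul (measurable_gfbmKernel α γ s)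
    (measurable_gfbmKernel α γ t) (hint s hs) (hint t ht)).congr' ?_
  filter_upwards [self_mem_nhdsWithin] with a (ha : 0 < a)
  have h := Measure.integral_comp_mul_left
    (fun u => gfbmKernel α γ (a * s) u * gfbmKernel α γ t u) a
  simp only [gfbmKernel_smul α γ _ _ ha, smul_eq_mul, abs_of_pos (inv_pos.2 ha)] at h
  rw [← gfbmCov_eq_integral_kernel] at h
  have h2 : gfbmCov α γ (a * s) t = a * (a⁻¹ * gfbmCov α γ (a * s) t) := by
    field_simp
  rw [h2, ← h, ← integral_const_mul, ← integral_const_mul]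
  congr 1; ext v
  have e : a ^ (1 / 2 : ℝ) = a ^ (-(α - γ / 2 + 1 / 2)) * (a * a ^ (α - γ / 2)) := by
    nth_rewrite 3 [← Real.rpow_one a]
    rw [← Real.rpow_add ha, ← Real.rpow_add ha]
    congr 1; ring
  rw [e]; ring

/-- Continuous real paths, with the σ-algebra generated by the evaluations. -/
abbrev ContPath : Type := {x : ℝ → ℝ // Continuous x}

theorem ContPath.measurable_eval (t : ℝ) : Measurable fun x : ContPath => x.1 t :=
  (measurable_pi_apply t).comp measurable_subtype_coe

/-- A finite measure on continuous paths is determined by the characteristic functions of its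
finite-dimensional marginals. -/
theorem ContPath.measure_ext {μ ν : Measure ContPath} [IsFiniteMeasure μ] [IsFiniteMeasure ν]
    (h : ∀ (I : Finset ℝ) (c : I → ℝ),
      ∫ x, Complex.exp ((∑ i, c i * x.1 i : ℝ) * Complex.I) ∂μ =
        ∫ x, Complex.exp ((∑ i, c i * x.1 i : ℝ) * Complex.I) ∂ν) : μ = ν := by
  have hmap : μ.map Subtype.val = ν.map Subtype.val := by
    refine IsProjectiveLimit.unique (P := fun I : Finset ℝ => (μ.map Subtype.val).map I.restrict)
      (fun I => rfl) fun I => ?_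
    change (ν.map Subtype.val).map I.restrict = (μ.map Subtype.val).map I.restrict
    rw [Measure.map_map (Finset.measurable_restrict I) measurable_subtype_coe,
      Measure.map_map (Finset.measurable_restrict I) measurable_subtype_coe]
    refine Measure.ext_of_charFunDual ?_
    ext L
    have hm : Measurable (I.restrict ∘ Subtype.val : ContPath → (I → ℝ)) :=
      (Finset.measurable_restrict I).comp measurable_subtype_coe
    have hL : ∀ x : ContPath, L ((I.restrict ∘ Subtype.val) x) =
        ∑ i : I, L (Pi.single i 1) * x.1 i := fun x => by
      have := LinearMap.pi_apply_eq_sum_univ (L : (I → ℝ) →ₗ[ℝ] ℝ) ((I.restrict ∘ Subtype.val) x)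
      simp only [ContinuousLinearMap.coe_coe, smul_eq_mul] at this
      rw [this]
      refine Finset.sum_congr rfl fun i _ => ?_
      rw [mul_comm]
      congr 2
      ext j
      simp [Pi.single_apply, eq_comm]
    rw [charFunDual_apply, charFunDual_apply, integral_map hm.aemeasurable
      (by fun_prop), integral_map hm.aemeasurable (by fun_prop)]
    simp_rw [hL]
    exact (h I _).symm
  ext s hs
  obtain ⟨t, ht, rfl⟩ := hs
  rw [← Measure.map_apply measurable_subtype_coe ht, hmap,
    Measure.map_apply measurable_subtype_coe ht]

section Gaussian

variable {Ω : Type*} [MeasurableSpace Ω] {P : Measure Ω} {X : ℝ → Ω → ℝ}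

theorem IsCenteredGaussianProcess.aemeasurable (hG : IsCenteredGaussianProcess P X) (t : ℝ) :
    AEMeasurable (X t) P := by
  obtain ⟨v, hv⟩ := hG 1 (fun _ => t) (fun _ => 1)
  simp only [Finset.univ_unique, Finset.sum_singleton, one_mul] at hv
  exact aemeasurable_of_map_neZero (by rw [hv]; infer_instance)

theorem IsCenteredGaussianProcess.memLp_two (hG : IsCenteredGaussianProcess P X) (t : ℝ) :
    MemLp (X t) 2 P := by
  obtain ⟨v, hv⟩ := hG 1 (fun _ => t) (fun _ => 1)
  simp only [Finset.univ_unique, Finset.sum_singleton, one_mul] at hv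
  have h := memLp_id_gaussianReal' (μ := 0) (v := v) 2 (by simp)
  rw [← hv] at h
  exact (memLp_map_measure_iff (by fun_prop) (hG.aemeasurable t)).1 h

/-- Joint characteristic function of a centered Gaussian process. -/
theorem IsCenteredGaussianProcess.integral_exp (hG : IsCenteredGaussianProcess P X)
    {K : ℝ → ℝ → ℝ} (hK : ∀ s t, ∫ ω, X s ω * X t ω ∂P = K s t)
    {ι : Type*} [Fintype ι] (t c : ι → ℝ) :
    ∫ ω, Complex.exp ((∑ i, c i * X (t i) ω : ℝ) * Complex.I) ∂P =
      Complex.exp (-((∑ i, ∑ j, c i * c j * K (t i) (t j) : ℝ) : ℂ) / 2) := by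
  let e := Fintype.equivFin ι
  obtain ⟨v, hv⟩ := hG _ (t ∘ e.symm) (c ∘ e.symm)
  have hsum : ∀ ω, ∑ i, (c ∘ e.symm) i * X ((t ∘ e.symm) i) ω = ∑ i, c i * X (t i) ω := fun ω =>
    e.symm.sum_comp fun i => c i * X (t i) ω
  simp_rw [hsum] at hv
  have hZ : AEMeasurable (fun ω => ∑ i, c i * X (t i) ω) P :=
    aemeasurable_of_map_neZero (by rw [hv]; infer_instance)
  have hvar : (v : ℝ) = ∑ i, ∑ j, c i * c j * K (t i) (t j) := by
    have h1 : ∫ x, x ^ 2 ∂(gaussianReal 0 v) = v := by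
      rw [← variance_id_gaussianReal (μ := 0) (v := v), variance_of_integral_eq_zero
        aemeasurable_id (by simp)]
      rfl
    rw [← h1, ← hv, integral_map hZ (by fun_prop)]
    have h2 : ∀ ω, (∑ i, c i * X (t i) ω) ^ 2 =
        ∑ i, ∑ j, c i * c j * (X (t i) ω * X (t j) ω) := fun ω => by
      rw [sq, Finset.sum_mul_sum]
      refine Finset.sum_congr rfl fun i _ => Finset.sum_congr rfl fun j _ => by ring
    have h3 : ∀ i j, Integrable (fun ω => c i * c j * (X (t i) ω * X (t j) ω)) P := fun i j =>
      ((hG.memLp_two (t i)).integrable_mul (hG.memLp_two (t j))).const_mul _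
    simp_rw [h2]
    rw [integral_finsetSum _ fun i _ => integrable_finsetSum _ fun j _ => h3 i j]
    refine Finset.sum_congr rfl fun i _ => ?_
    rw [integral_finsetSum _ fun j _ => h3 i j]
    refine Finset.sum_congr rfl fun j _ => ?_
    rw [integral_const_mul, hK]
  have hc := charFun_gaussianReal (μ := 0) (v := v) 1
  rw [← hv, charFun_apply_real, integral_map hZ (by fun_prop)] at hc
  rw [← hvar]
  simpa [neg_div] using hc

end Gaussian

/-- In a Hilbert space, a vector with constant inner product against a bounded, asymptotically
orthogonal sequence is orthogonal to that sequence. -/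
theorem inner_eq_zero_of_tendsto_inner {E : Type*} [NormedAddCommGroup E]
    [InnerProductSpace ℂ E] [CompleteSpace E] {f : ℕ → E} {z : E} {d : ℂ} {C : ℝ}
    (hC : ∀ k, ‖f k‖ ≤ C)
    (hf : ∀ j, Tendsto (fun k => inner ℂ (f j) (f k)) atTop (nhds 0))
    (hz : ∀ k, inner ℂ z (f k) = d) : d = 0 := by
  let W := (Submodule.span ℂ (Set.range f)).topologicalClosure
  have hW : IsClosed (W : Set E) := Submodule.isClosed_topologicalClosure _
  have : CompleteSpace W := hW.completeSpace_coe
  have hfW : ∀ k, f k ∈ W := fun k =>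
    Submodule.le_topologicalClosure _ (Submodule.subset_span (Set.mem_range_self k))
  have hspan : ∀ w ∈ Submodule.span ℂ (Set.range f),
      Tendsto (fun k => inner ℂ w (f k)) atTop (nhds 0) := by
    intro w hw
    induction hw using Submodule.span_induction with
    | mem x hx => obtain ⟨j, rfl⟩ := hx; exact hf j
    | zero => simp
    | add x y _ _ hx hy => simpa [inner_add_left] using hx.add hy
    | smul a x _ hx => simpa [inner_smul_left] using hx.mul_const _
  have hC0 : 0 ≤ C := (norm_nonneg _).trans (hC 0)
  by_contra hd
  set p : E := W.starProjection z with hp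
  have hpW : p ∈ closure (Submodule.span ℂ (Set.range f) : Set E) := by
    have : p ∈ W := Submodule.starProjection_apply_mem W z
    exact this
  have hpz : ∀ k, inner ℂ p (f k) = d := fun k => by
    rw [← hz k, hp, Submodule.inner_starProjection_left_eq_right,
      Submodule.starProjection_eq_self_iff.2 (hfW k)]
  have hd' : 0 < ‖d‖ := norm_pos_iff.2 hd
  obtain ⟨w, hw, hpw⟩ := Metric.mem_closure_iff.1 hpW (‖d‖ / (2 * (C + 1))) (by positivity)
  have h1 := (hspan w hw).norm
  rw [norm_zero] at h1
  obtain ⟨k, hk⟩ := (h1.eventually (gt_mem_nhds (half_pos hd'))).exists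
  have h2 : ‖d‖ ≤ ‖inner ℂ w (f k)‖ + ‖inner ℂ (p - w) (f k)‖ := by
    rw [← hpz k, show inner ℂ p (f k) = inner ℂ w (f k) + inner ℂ (p - w) (f k) by
      rw [← inner_add_left]; congr 1; abel]
    exact norm_add_le _ _
  have h3 : ‖inner ℂ (p - w) (f k)‖ ≤ ‖d‖ / (2 * (C + 1)) * C := by
    refine (norm_inner_le_norm _ _).trans ?_
    rw [dist_eq_norm] at hpw
    exact mul_le_mul hpw.le (hC k) (norm_nonneg _) (by positivity)
  have h4 : ‖d‖ / (2 * (C + 1)) * C ≤ ‖d‖ / 2 := by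
    rw [div_mul_eq_mul_div, div_le_div_iff₀ (by positivity) (by positivity)]
    nlinarith
  linarith

/-- The self-similar rescaling `x ↦ a^{-h} x(a ·)` of continuous paths. -/
noncomputable def ContPath.rescale (a h : ℝ) (x : ContPath) : ContPath :=
  ⟨fun t => a ^ (-h) * x.1 (a * t), by have := x.2; fun_prop⟩

theorem ContPath.measurable_rescale (a h : ℝ) : Measurable (ContPath.rescale a h) :=
  Measurable.subtype_mk (measurable_pi_lambda _ fun t =>
    (ContPath.measurable_eval (a * t)).const_mul _)

theorem ContPath.rescale_iterate {a : ℝ} (ha : 0 < a) (h : ℝ) (k : ℕ) (x : ContPath) (t : ℝ) :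
    (((ContPath.rescale a h)^[k]) x).1 t = (a ^ k) ^ (-h) * x.1 (a ^ k * t) := by
  induction k generalizing x with
  | zero => simp
  | succ k ih =>
    rw [Function.iterate_succ_apply, ih]
    simp only [ContPath.rescale]
    rw [pow_succ, Real.mul_rpow (by positivity) ha.le]
    ring_nf

section Ergodic

variable {ν : Measure ContPath} [IsProbabilityMeasure ν] {K : ℝ → ℝ → ℝ} {a h : ℝ}

theorem ContPath.measurable_expSum {ι : Type*} [Fintype ι] (t c : ι → ℝ) :
    Measurable fun x : ContPath =>
      Complex.exp ((∑ i, c i * x.1 (t i) : ℝ) * Complex.I) := by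
  have h : Measurable fun x : ContPath => ∑ i, c i * x.1 (t i) :=
    Finset.measurable_sum _ fun i _ => (ContPath.measurable_eval (t i)).const_mul (c i)
  fun_prop

theorem ContPath.measurePreserving_rescale (ha : 0 < a)
    (hG : IsCenteredGaussianProcess ν fun t x => x.1 t)
    (hK : ∀ s t, ∫ x, x.1 s * x.1 t ∂ν = K s t)
    (hss : ∀ s t, K (a * s) (a * t) = a ^ (2 * h) * K s t) :
    MeasurePreserving (ContPath.rescale a h) ν ν := by
  refine ⟨ContPath.measurable_rescale a h, ?_⟩
  have := Measure.isProbabilityMeasure_map (μ := ν) (ContPath.measurable_rescale a h).aemeasurable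
  refine ContPath.measure_ext fun I c => ?_
  rw [integral_map (ContPath.measurable_rescale a h).aemeasurable
    (ContPath.measurable_expSum (fun i : I => (i : ℝ)) c).aestronglyMeasurable]
  have e1 := hG.integral_exp hK (fun i : I => a * (i : ℝ)) (fun i => c i * a ^ (-h))
  have e2 := hG.integral_exp hK (fun i : I => (i : ℝ)) c
  simp only [ContPath.rescale, ← mul_assoc]
  rw [e1, e2]
  congr 4
  refine Finset.sum_congr rfl fun i _ => Finset.sum_congr rfl fun j _ => ?_
  have hp : a ^ (-h) * a ^ (-h) * a ^ (2 * h) = 1 := by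
    rw [← Real.rpow_add ha, ← Real.rpow_add ha, ← Real.rpow_zero a]
    congr 1; ring
  rw [hss]
  linear_combination (c i * c j * K i j) * hp

theorem ContPath.cov_iterate (ha : 0 < a)
    (hss : ∀ s t, K (a * s) (a * t) = a ^ (2 * h) * K s t) (k : ℕ) (s t : ℝ) :
    (a ^ k) ^ (-h) * (a ^ k) ^ (-h) * K (a ^ k * s) (a ^ k * t) = K s t := by
  have key : K (a ^ k * s) (a ^ k * t) = (a ^ k) ^ (2 * h) * K s t := by
    induction k with
    | zero => simp
    | succ k ih =>
      rw [pow_succ', mul_assoc, mul_assoc, hss, ih, Real.mul_rpow ha.le (by positivity)]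
      ring
  have hp : 0 < a ^ k := by positivity
  rw [key, ← mul_assoc, ← Real.rpow_add hp, ← Real.rpow_add hp,
    show -h + -h + 2 * h = 0 by ring, Real.rpow_zero, one_mul]

/-- A self-similar centered Gaussian law on continuous paths whose rescalings decorrelate
asymptotically is ergodic under rescaling. -/
theorem ContPath.ergodic_rescale (ha : 0 < a)
    (hG : IsCenteredGaussianProcess ν fun t x => x.1 t)
    (hK : ∀ s t, ∫ x, x.1 s * x.1 t ∂ν = K s t)
    (hss : ∀ s t, K (a * s) (a * t) = a ^ (2 * h) * K s t)
    (hmix : ∀ s t, Tendsto (fun k : ℕ => (a ^ k) ^ (-h) * K (a ^ k * s) t) atTop (nhds 0)) :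
    Ergodic (ContPath.rescale a h) ν := by
  have hT := ContPath.measurePreserving_rescale ha hG hK hss
  refine ⟨hT, ⟨fun s hs hsT => ?_⟩⟩
  have hKc : ∀ s t, K s t = K t s := fun s t => by simp_rw [← hK, mul_comm]
  suffices hmain : ν.restrict s = ν s • ν by
    have h1 : ν s = ν s * ν s := by
      have := congrArg (fun m : Measure ContPath => m s) hmain
      simpa using this
    rw [Filter.eventuallyConst_set']
    have hfin : ν s ≠ ⊤ := measure_ne_top _ _
    by_cases h0 : ν s = 0
    · left; exact ae_eq_empty.2 h0
    · right
      have h2 : ν s = 1 := by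
        have : ν s * 1 = ν s * ν s := by rw [mul_one]; exact h1
        exact ((ENNReal.mul_right_inj h0 hfin).1 this).symm
      rw [ae_eq_univ, prob_compl_eq_zero_iff hs]
      exact h2
  have : IsFiniteMeasure (ν s • ν) := Measure.smul_finite _ (measure_ne_top _ _)
  refine ContPath.measure_ext fun I c => ?_
  set V : ContPath → ℂ := fun x => Complex.exp ((∑ i, c i * x.1 i : ℝ) * Complex.I) with hV
  have hVm : Measurable V := ContPath.measurable_expSum (fun i : I => (i : ℝ)) c
  have hVn : ∀ x, ‖V x‖ = 1 := fun x => Complex.norm_exp_ofReal_mul_I _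
  set T := ContPath.rescale a h
  set m : ℂ := ∫ x, V x ∂ν with hm
  have hTk : ∀ k, MeasurePreserving (T^[k]) ν ν := fun k => hT.iterate k
  have hsTk : ∀ k, (T^[k]) ⁻¹' s = s := fun k => by
    induction k with
    | zero => rfl
    | succ k ih => rw [Function.iterate_succ, Set.preimage_comp, ih, hsT]
  have hbdd : ∀ k, MemLp (fun x => V (T^[k] x) - m) 2 ν := fun k =>
    MemLp.of_bound ((hVm.comp (hTk k).measurable).sub_const m).aestronglyMeasurable (1 + ‖m‖)
      (Eventually.of_forall fun x => (norm_sub_le _ _).trans (by rw [hVn]))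
  have hint : ∀ k, Integrable (fun x => V (T^[k] x)) ν := fun k =>
    Integrable.of_bound (hVm.comp (hTk k).measurable).aestronglyMeasurable 1
      (Eventually.of_forall fun x => (hVn _).le)
  have hmk : ∀ k, ∫ x, V (T^[k] x) ∂ν = m := fun k => by
    rw [hm, ← (hTk k).map_eq, integral_map (hTk k).measurable.aemeasurable
      hVm.aestronglyMeasurable, (hTk k).map_eq]
  have hzero : (∫ x in s, V x ∂ν) - (ν.real s : ℂ) * m = 0 := by
    refine inner_eq_zero_of_tendsto_inner (f := fun k => (hbdd k).toLp _)
      (z := indicatorConstLp 2 hs (measure_ne_top ν s) (1 : ℂ)) (C := 1 + ‖m‖) ?_ ?_ ?_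
    · intro k
      refine (Lp.norm_le_of_ae_bound (C := 1 + ‖m‖) (by positivity) ?_).trans ?_
      · filter_upwards [(hbdd k).coeFn_toLp] with x hx
        rw [hx]
        exact (norm_sub_le _ _).trans (by rw [hVn])
      · simp [measureUnivNNReal]
    · intro j
      have hinner : ∀ k, inner ℂ ((hbdd j).toLp _) ((hbdd k).toLp _) =
          (∫ x, (starRingEnd ℂ) (V (T^[j] x)) * V (T^[k] x) ∂ν) - (starRingEnd ℂ) m * m := by
        intro k
        rw [L2.inner_def]
        have h1 : ∀ᵐ x ∂ν, inner ℂ ((hbdd j).toLp _ x) ((hbdd k).toLp _ x) =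
            (starRingEnd ℂ) (V (T^[j] x)) * V (T^[k] x) - (starRingEnd ℂ) (V (T^[j] x)) * m
              - (starRingEnd ℂ) m * V (T^[k] x) + (starRingEnd ℂ) m * m := by
          filter_upwards [(hbdd j).coeFn_toLp, (hbdd k).coeFn_toLp] with x hx1 hx2
          rw [hx1, hx2, RCLike.inner_apply, map_sub]
          ring
        have i0 : Integrable (fun x => (starRingEnd ℂ) (V (T^[j] x))) ν :=
          Integrable.of_bound (RCLike.continuous_conj.measurable.comp
            (hVm.comp (hTk j).measurable)).aestronglyMeasurable 1
            (Eventually.of_forall fun x => by simp [hVn])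
        have i1 : Integrable (fun x => (starRingEnd ℂ) (V (T^[j] x)) * V (T^[k] x)) ν :=
          Integrable.of_bound ((RCLike.continuous_conj.measurable.comp
            (hVm.comp (hTk j).measurable)).mul
            (hVm.comp (hTk k).measurable)).aestronglyMeasurable 1
            (Eventually.of_forall fun x => by simp [hVn])
        have i2 : Integrable (fun x => (starRingEnd ℂ) (V (T^[j] x)) * m) ν := i0.mul_const m
        have i3 : Integrable (fun x => (starRingEnd ℂ) m * V (T^[k] x)) ν := (hint k).const_mul _
        have i4 : Integrable (fun x => (starRingEnd ℂ) (V (T^[j] x)) * V (T^[k] x) -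
          (starRingEnd ℂ) (V (T^[j] x)) * m) ν := i1.sub i2
        have i5 : Integrable (fun x => (starRingEnd ℂ) (V (T^[j] x)) * V (T^[k] x) -
          (starRingEnd ℂ) (V (T^[j] x)) * m - (starRingEnd ℂ) m * V (T^[k] x)) ν := i4.sub i3
        rw [integral_congr_ae h1, integral_add i5 (integrable_const _), integral_sub i4 i3,
          integral_sub i1 i2, integral_mul_const, integral_const_mul, hmk, integral_conj, hmk]
        simp
      simp_rw [hinner]
      set q : ℝ := ∑ i, ∑ l, c i * c l * K i l with hq
      have hmq : m = Complex.exp (-(q : ℂ) / 2) :=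
        hG.integral_exp hK (fun i : I => (i : ℝ)) c
      have hmm : (starRingEnd ℂ) m * m = Complex.exp (-((2 * q - 2 * 0 : ℝ) : ℂ) / 2) := by
        rw [hmq, ← Complex.exp_conj, ← Complex.exp_add]
        congr 1
        simp only [map_div₀, map_neg, Complex.conj_ofReal, map_ofNat]
        push_cast; ring
      set D : ℕ → ℝ := fun k => ∑ i, ∑ l,
        c i * c l * (a ^ j) ^ (-h) * ((a ^ k) ^ (-h) * K (a ^ k * l) (a ^ j * i)) with hD
      have hDlim : Tendsto D atTop (nhds 0) := by
        have h0 : (0 : ℝ) = ∑ i : I, ∑ l : I, c i * c l * (a ^ j) ^ (-h) * 0 := by simp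
        rw [h0]
        exact tendsto_finsetSum _ fun i _ => tendsto_finsetSum _ fun l _ =>
          (hmix _ _).const_mul _
      have hexp : ∀ k, ∫ x, (starRingEnd ℂ) (V (T^[j] x)) * V (T^[k] x) ∂ν =
          Complex.exp (-((2 * q - 2 * D k : ℝ) : ℂ) / 2) := by
        intro k
        have h1 := hG.integral_exp hK
          (Sum.elim (fun i : I => a ^ j * (i : ℝ)) (fun i : I => a ^ k * (i : ℝ)))
          (Sum.elim (fun i : I => -(c i * (a ^ j) ^ (-h))) (fun i : I => c i * (a ^ k) ^ (-h)))
        have h2 : ∀ x : ContPath, (starRingEnd ℂ) (V (T^[j] x)) * V (T^[k] x) =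
            Complex.exp ((∑ p, (Sum.elim (fun i : I => -(c i * (a ^ j) ^ (-h)))
              (fun i : I => c i * (a ^ k) ^ (-h)) p) * x.1 (Sum.elim (fun i : I => a ^ j * (i : ℝ))
              (fun i : I => a ^ k * (i : ℝ)) p) : ℝ) * Complex.I) := by
          intro x
          rw [hV]
          simp only [T, ContPath.rescale_iterate ha]
          rw [← Complex.exp_conj, ← Complex.exp_add]
          congr 1
          rw [map_mul, Complex.conj_ofReal, Complex.conj_I, mul_neg, ← neg_mul, ← add_mul,
            ← Complex.ofReal_neg, ← Complex.ofReal_add, ← Finset.sum_neg_distrib,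
            Fintype.sum_sum_type]
          simp only [Sum.elim_inl, Sum.elim_inr, mul_assoc, neg_mul]
        simp_rw [h2]
        rw [h1]
        congr 4
        simp only [Fintype.sum_sum_type, Sum.elim_inl, Sum.elim_inr]
        rw [Finset.sum_add_distrib.symm]
        simp only [← Finset.sum_add_distrib]
        have hsw : D k = ∑ i, ∑ l,
            c i * c l * (a ^ j) ^ (-h) * ((a ^ k) ^ (-h) * K (a ^ k * i) (a ^ j * l)) := by
          rw [hD, Finset.sum_comm]
          refine Finset.sum_congr rfl fun i _ => Finset.sum_congr rfl fun l _ => by ring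
        rw [two_mul (D k)]
        nth_rewrite 2 [hsw]
        rw [hD, hq, ← Finset.sum_add_distrib, Finset.mul_sum, ← Finset.sum_sub_distrib]
        refine Finset.sum_congr rfl fun i _ => ?_
        rw [← Finset.sum_add_distrib, Finset.mul_sum, ← Finset.sum_sub_distrib]
        refine Finset.sum_congr rfl fun l _ => ?_
        rw [hKc (a ^ j * i) (a ^ k * l)]
        linear_combination c i * c l * ContPath.cov_iterate ha hss j i l +
          c i * c l * ContPath.cov_iterate ha hss k i l
      simp_rw [hexp, hmm]
      rw [← sub_self (Complex.exp (-((2 * q - 2 * 0 : ℝ) : ℂ) / 2))]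
      refine Tendsto.sub_const ?_ _
      have hcont : Continuous fun d : ℝ => Complex.exp (-((2 * q - 2 * d : ℝ) : ℂ) / 2) := by
        fun_prop
      exact (hcont.tendsto 0).comp hDlim
    · intro k
      rw [L2.inner_indicatorConstLp_one]
      have h1 : ∫ x in s, (hbdd k).toLp _ x ∂ν = ∫ x in s, (V (T^[k] x) - m) ∂ν :=
        integral_congr_ae (ae_restrict_of_ae (hbdd k).coeFn_toLp)
      have h2 : ∫ x in s, V (T^[k] x) ∂ν = ∫ x in s, V x ∂ν := by
        have h3 := (hTk k).restrict_preimage hs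
        rw [hsTk k] at h3
        conv_rhs => rw [← h3.map_eq]
        rw [integral_map (hTk k).measurable.aemeasurable hVm.aestronglyMeasurable]
      rw [h1, integral_sub (hint k).integrableOn (integrable_const _), h2, setIntegral_const]
      simp
  rw [integral_smul_measure, sub_eq_zero.1 hzero, Complex.real_smul]
  rfl

end Ergodic

section Functional

/-- The evaluation process on continuous paths. -/
def ContPath.eval (t : ℝ) (x : ContPath) : ℝ := x.1 t

/-- The fractional integral rewritten over the unit interval; it agrees with `fracInt` at
nonnegative times and is continuous at every time. -/
noncomputable def ContPath.unitFracInt (θ : ℝ) (t : ℝ) (x : ContPath) : ℝ :=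
  (Real.Gamma θ)⁻¹ * (|t| ^ θ * ∫ v in (0:ℝ)..1, (1 - v) ^ (θ - 1) * x.1 (t * v))

theorem ContPath.fracInt_eq_unitFracInt {θ : ℝ} (hθ : 0 < θ) {t : ℝ} (ht : 0 ≤ t) (x : ContPath) :
    fracInt θ ContPath.eval t x = ContPath.unitFracInt θ t x := by
  unfold fracInt ContPath.unitFracInt ContPath.eval
  rcases ht.eq_or_lt with rfl | ht
  · simp [Real.zero_rpow hθ.ne']
  congr 1
  have h := intervalIntegral.integral_comp_mul_left (a := 0) (b := 1)
    (fun u => (t - u) ^ (θ - 1) * x.1 u) ht.ne'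
  rw [mul_zero, mul_one, smul_eq_mul] at h
  rw [abs_of_pos ht, ← intervalIntegral.integral_const_mul]
  have h2 : ∫ u in (0:ℝ)..t, (t - u) ^ (θ - 1) * x.1 u =
      t * (t⁻¹ * ∫ u in (0:ℝ)..t, (t - u) ^ (θ - 1) * x.1 u) := by field_simp
  rw [h2, ← h, ← intervalIntegral.integral_const_mul]
  refine intervalIntegral.integral_congr fun v hv => ?_
  rw [uIcc_of_le zero_le_one] at hv
  have h3 : t - t * v = t * (1 - v) := by ring
  have h4 : t ^ θ = t * t ^ (θ - 1) := by
    nth_rewrite 2 [← Real.rpow_one t]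
    rw [← Real.rpow_add ht]; congr 1; ring
  rw [h3, Real.mul_rpow ht.le (by linarith [hv.2]), h4]
  ring

theorem ContPath.continuous_unitFracInt {θ : ℝ} (hθ : 0 < θ) (x : ContPath) :
    Continuous fun t => ContPath.unitFracInt θ t x := by
  have hx := x.2
  have hw : IntervalIntegrable (fun v : ℝ => (1 - v) ^ (θ - 1)) volume 0 1 := by
    have := (intervalIntegral.intervalIntegrable_rpow' (a := 1) (b := 0)
      (show -1 < θ - 1 by linarith)).comp_sub_left 1
    simpa using this
  have hJ : Continuous fun t => ∫ v in (0:ℝ)..1, (1 - v) ^ (θ - 1) * x.1 (t * v) := by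
    rw [continuous_iff_continuousAt]
    intro t₀
    obtain ⟨C, hC⟩ := (isCompact_Icc (a := -(|t₀| + 1)) (b := |t₀| + 1)).exists_bound_of_continuousOn
      hx.continuousOn
    refine intervalIntegral.continuousAt_of_dominated_interval
      (bound := fun v => (1 - v) ^ (θ - 1) * C) ?_ ?_ (hw.mul_const C) ?_
    · refine Eventually.of_forall fun t => ?_
      exact (Measurable.mul (by fun_prop) (by fun_prop)).aestronglyMeasurable
    · filter_upwards [Metric.ball_mem_nhds t₀ one_pos] with t ht
      refine Eventually.of_forall fun v hv => ?_
      rw [uIoc_of_le zero_le_one] at hv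
      have h1 : 0 ≤ (1 - v) ^ (θ - 1) := Real.rpow_nonneg (by linarith [hv.2]) _
      rw [norm_mul, Real.norm_of_nonneg h1]
      refine mul_le_mul_of_nonneg_left (hC _ ?_) h1
      rw [Set.mem_Icc, ← abs_le, abs_mul, abs_of_pos hv.1]
      have h2 : |t| ≤ |t₀| + 1 := by
        have := abs_sub_abs_le_abs_sub t t₀
        rw [Metric.mem_ball, Real.dist_eq] at ht
        linarith
      nlinarith [abs_nonneg t, hv.1, hv.2]
    · refine Eventually.of_forall fun v _ => ?_
      exact Continuous.continuousAt (by fun_prop)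
  unfold ContPath.unitFracInt
  refine continuous_const.mul (Continuous.mul ?_ hJ)
  exact continuous_abs.rpow_const fun _ => Or.inr hθ.le

theorem ContPath.measurable_unitFracInt (θ t : ℝ) : Measurable (ContPath.unitFracInt θ t) := by
  have hu : Measurable (Function.uncurry fun (r : ℝ) (x : ContPath) => x.1 r) :=
    measurable_uncurry_of_continuous_of_measurable (fun x => x.2) ContPath.measurable_eval
  have h1 : Measurable fun p : ContPath × ℝ => (1 - p.2) ^ (θ - 1) * p.1.1 (t * p.2) := by
    have : Measurable fun p : ContPath × ℝ => p.1.1 (t * p.2) :=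
      hu.comp (f := fun p : ContPath × ℝ => (t * p.2, p.1)) (by fun_prop)
    fun_prop
  unfold ContPath.unitFracInt
  refine Measurable.const_mul (Measurable.const_mul ?_ _) _
  simp_rw [intervalIntegral.integral_of_le zero_le_one]
  exact (h1.stronglyMeasurable.integral_prod_right' (ν := volume.restrict (Ioc 0 1))).measurable

/-- The running maximum of the fractional integral as a supremum over the unit interval. -/
noncomputable def ContPath.unitRunSup (θ : ℝ) (x : ContPath) (t : ℝ) : ℝ :=
  sSup ((fun v => |ContPath.unitFracInt θ (t * v) x|) '' Icc 0 1)

theorem ContPath.runSup_eq_unitRunSup {θ : ℝ} (hθ : 0 < θ) {t : ℝ} (ht : 0 < t) (x : ContPath) :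
    runSup (fracInt θ ContPath.eval) t x = ContPath.unitRunSup θ x t := by
  unfold runSup ContPath.unitRunSup
  rw [← sSup_range]
  congr 1
  ext y
  constructor
  · rintro ⟨⟨s, hs⟩, rfl⟩
    refine ⟨s / t, ⟨div_nonneg hs.1 ht.le, (div_le_one ht).2 hs.2⟩, ?_⟩
    simp only
    rw [mul_div_cancel₀ s ht.ne', ContPath.fracInt_eq_unitFracInt hθ hs.1]
  · rintro ⟨v, hv, rfl⟩
    have h0 : 0 ≤ t * v := mul_nonneg ht.le hv.1
    refine ⟨⟨t * v, h0, by nlinarith [hv.2]⟩, ?_⟩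
    simp only
    rw [ContPath.fracInt_eq_unitFracInt hθ h0]

theorem ContPath.continuous_unitRunSup {θ : ℝ} (hθ : 0 < θ) (x : ContPath) :
    Continuous (ContPath.unitRunSup θ x) := by
  have h := ContPath.continuous_unitFracInt hθ x
  refine isCompact_Icc.continuous_sSup (f := fun t v => |ContPath.unitFracInt θ (t * v) x|) ?_
  exact (h.comp (continuous_fst.mul continuous_snd)).abs

theorem ContPath.measurable_unitRunSup {θ : ℝ} (hθ : 0 < θ) (t : ℝ) :
    Measurable fun x => ContPath.unitRunSup θ x t := by
  refine measurable_of_Iic fun c => ?_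
  have : (fun x => ContPath.unitRunSup θ x t) ⁻¹' Iic c =
      ⋂ n, {x | |ContPath.unitFracInt θ (t * (TopologicalSpace.denseSeq (Icc (0:ℝ) 1) n : ℝ)) x|
        ≤ c} := by
    ext x
    have hc : Continuous fun v : ℝ => |ContPath.unitFracInt θ (t * v) x| :=
      ((ContPath.continuous_unitFracInt hθ x).comp (continuous_const_mul t)).abs
    simp only [mem_preimage, mem_Iic, mem_iInter, ContPath.unitRunSup]
    rw [csSup_le_iff (isCompact_Icc.image hc).bddAbove ((nonempty_Icc.2 zero_le_one).image _)]
    constructor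
    · exact fun h n => h _ ⟨_, (TopologicalSpace.denseSeq (Icc (0:ℝ) 1) n).2, rfl⟩
    · rintro h _ ⟨v, hv, rfl⟩
      have hcl : IsClosed {w : Icc (0:ℝ) 1 | |ContPath.unitFracInt θ (t * w) x| ≤ c} :=
        isClosed_le (hc.comp continuous_subtype_val) continuous_const
      have huniv := (TopologicalSpace.denseRange_denseSeq (Icc (0:ℝ) 1)).closure_range
      have hsub := closure_minimal (range_subset_iff.2 h) hcl
      rw [huniv] at hsub
      exact hsub (mem_univ (⟨v, hv⟩ : Icc (0:ℝ) 1))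
  rw [this]
  exact MeasurableSet.iInter fun n =>
    measurableSet_le (ContPath.measurable_unitFracInt θ _).abs measurable_const

/-- The lower limit at `0+` of a family of measurable functions depending continuously on a
parameter is measurable. -/
theorem measurable_liminf_nhdsGT_zero {S : Type*} [MeasurableSpace S] {g : ℝ → S → ENNReal}
    (hm : ∀ t, Measurable (g t)) {δ : ℝ} (hδ : 0 < δ)
    (hc : ∀ s, ContinuousOn (fun t => g t s) (Ioo 0 δ)) :
    Measurable fun s => liminf (fun t => g t s) (nhdsWithin 0 (Ioi 0)) := by
  have hdense : ∀ (s : S) (ε : ℝ), ε ≤ δ →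
      ⨅ t ∈ Ioo 0 ε, g t s = ⨅ q : ℚ, ⨅ _ : (q : ℝ) ∈ Ioo 0 ε, g q s := by
    intro s ε hε
    refine le_antisymm (le_iInf₂ fun q hq => iInf₂_le (q : ℝ) hq) (le_iInf₂ fun t ht => ?_)
    by_contra! hlt
    have hopen : IsOpen (Ioo 0 ε ∩ (fun t => g t s) ⁻¹'
        Iio (⨅ q : ℚ, ⨅ _ : (q : ℝ) ∈ Ioo 0 ε, g q s)) :=
      ((hc s).mono (Ioo_subset_Ioo_right hε)).isOpen_inter_preimage isOpen_Ioo isOpen_Iio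
    obtain ⟨q, hq⟩ := Rat.denseRange_cast.exists_mem_open hopen ⟨t, ht, hlt⟩
    have hlt' : g q s < ⨅ q : ℚ, ⨅ _ : (q : ℝ) ∈ Ioo 0 ε, g q s := hq.2
    exact hlt'.not_ge (iInf₂_le q hq.1)
  have heq : ∀ s, liminf (fun t => g t s) (nhdsWithin 0 (Ioi 0)) =
      ⨆ n : ℕ, ⨅ q : ℚ, ⨅ _ : (q : ℝ) ∈ Ioo 0 (δ / (n + 1)), g q s := by
    intro s
    rw [(nhdsGT_basis (0:ℝ)).liminf_eq_iSup_iInf]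
    have hle : ∀ n : ℕ, δ / (n + 1) ≤ δ := fun n =>
      div_le_self hδ.le (by linarith [n.cast_nonneg (α := ℝ)])
    simp_rw [← hdense s _ (hle _)]
    refine le_antisymm (iSup₂_le fun ε hε => ?_) (iSup_le fun n => ?_)
    · obtain ⟨n, hn⟩ := exists_nat_gt (δ / ε)
      refine le_iSup_of_le n (biInf_mono (Ioo_subset_Ioo_right ?_))
      rw [div_lt_iff₀ hε] at hn
      rw [div_le_iff₀ (by positivity)]
      nlinarith
    · exact le_iSup₂_of_le (δ / (n + 1)) (by positivity) le_rfl
  simp_rw [heq]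
  exact Measurable.iSup fun n => Measurable.iInf fun q => Measurable.iInf fun _ => hm q

/-- Chung's lower limit at the origin, as a functional of the continuous path. -/
noncomputable def ContPath.chungLiminf (θ β κ : ℝ) (x : ContPath) : ENNReal :=
  liminf (fun t : ℝ => ENNReal.ofReal
    (ContPath.unitRunSup θ x t * (Real.log (Real.log (1 / t))) ^ β / t ^ κ))
    (nhdsWithin 0 (Ioi 0))

theorem log_log_one_div_pos {t : ℝ} (ht : t ∈ Ioo 0 (Real.exp (-1))) :
    0 < Real.log (1 / t) ∧ 0 < Real.log (Real.log (1 / t)) := by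
  have h : 1 < Real.log (1 / t) := by
    rw [one_div, Real.log_inv]
    have := (Real.log_lt_iff_lt_exp ht.1).2 ht.2
    linarith
  exact ⟨by linarith, Real.log_pos h⟩

theorem ContPath.measurable_chungLiminf {θ : ℝ} (hθ : 0 < θ) (β κ : ℝ) :
    Measurable (ContPath.chungLiminf θ β κ) := by
  refine measurable_liminf_nhdsGT_zero (fun t => ?_) (Real.exp_pos (-1)) fun x => ?_
  · exact (((ContPath.measurable_unitRunSup hθ t).mul_const _).div_const _).ennreal_ofReal
  · refine ENNReal.continuous_ofReal.comp_continuousOn ?_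
    have h1 : ContinuousOn (fun t : ℝ => 1 / t) (Ioo 0 (Real.exp (-1))) :=
      continuousOn_const.div continuousOn_id fun t ht => ht.1.ne'
    refine ContinuousOn.div (((ContPath.continuous_unitRunSup hθ x).continuousOn).mul
      (ContinuousOn.rpow_const (ContinuousOn.log (ContinuousOn.log h1 ?_) ?_) ?_))
      (continuousOn_id.rpow_const fun t ht => Or.inl ht.1.ne') ?_
    · exact fun t ht => (one_div_pos.2 ht.1).ne'
    · exact fun t ht => (log_log_one_div_pos ht).1.ne'
    · exact fun t ht => Or.inl (log_log_one_div_pos ht).2.ne'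
    · exact fun t ht => (Real.rpow_pos_of_pos ht.1 _).ne'

theorem ContPath.unitRunSup_rescale {θ : ℝ} (h : ℝ) {a t : ℝ} (ha : 0 < a) (x : ContPath) :
    ContPath.unitRunSup θ (ContPath.rescale a h x) t =
      a ^ (-(h + θ)) * ContPath.unitRunSup θ x (a * t) := by
  have hY : ∀ s, ContPath.unitFracInt θ s (ContPath.rescale a h x) =
      a ^ (-(h + θ)) * ContPath.unitFracInt θ (a * s) x := by
    intro s
    unfold ContPath.unitFracInt ContPath.rescale
    have e : ∀ v, (1 - v) ^ (θ - 1) * (a ^ (-h) * x.1 (a * (s * v))) =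
        a ^ (-h) * ((1 - v) ^ (θ - 1) * x.1 (a * s * v)) := fun v => by
      rw [mul_assoc a]; ring
    simp_rw [e]
    rw [intervalIntegral.integral_const_mul, abs_mul, abs_of_pos ha,
      Real.mul_rpow ha.le (abs_nonneg _), neg_add, Real.rpow_add ha]
    have h1 : a ^ (-θ) * a ^ θ = 1 := by rw [← Real.rpow_add ha]; simp
    linear_combination (-(Real.Gamma θ)⁻¹ * (|s| ^ θ) * a ^ (-h) *
      ∫ v in (0:ℝ)..1, (1 - v) ^ (θ - 1) * x.1 (a * s * v)) * h1
  have hp : 0 < a ^ (-(h + θ)) := Real.rpow_pos_of_pos ha _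
  unfold ContPath.unitRunSup
  simp_rw [hY, abs_mul, abs_of_pos hp, sSup_image']
  rw [Real.mul_iSup_of_nonneg hp.le]
  simp_rw [mul_assoc]

/-- The iterated logarithm weight is slowly varying at the origin. -/
theorem tendsto_log_log_ratio {a : ℝ} (ha : 0 < a) (β : ℝ) :
    Tendsto (fun t : ℝ => (Real.log (Real.log (1 / t))) ^ β /
      (Real.log (Real.log (1 / (a * t)))) ^ β) (nhdsWithin 0 (Ioi 0)) (nhds 1) := by
  have hu : Tendsto (fun t : ℝ => Real.log (1 / (a * t))) (nhdsWithin 0 (Ioi 0)) atTop := by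
    refine Real.tendsto_log_atTop.comp ?_
    have h1 : Tendsto (fun t : ℝ => a⁻¹ * t⁻¹) (nhdsWithin 0 (Ioi 0)) atTop :=
      tendsto_inv_nhdsGT_zero.const_mul_atTop (inv_pos.2 ha)
    exact h1.congr fun t => by rw [one_div, mul_inv]
  have hr : Tendsto (fun u : ℝ => Real.log (u + Real.log a) / Real.log u) atTop (nhds 1) := by
    have h1 := (Real.tendsto_log_comp_add_sub_log (Real.log a)).div_atTop Real.tendsto_log_atTop
    have h2 := h1.add_const 1
    rw [zero_add] at h2
    refine h2.congr' ?_
    filter_upwards [eventually_gt_atTop 1] with u hu1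
    have := (Real.log_pos hu1).ne'
    field_simp
    ring
  have hc := ((hr.comp hu).rpow_const (p := β) (Or.inl one_ne_zero))
  rw [Real.one_rpow] at hc
  refine hc.congr' ?_
  filter_upwards [self_mem_nhdsWithin, hu.eventually_gt_atTop (max 1 (1 - Real.log a))]
    with t (ht : 0 < t) h1
  have h2 : Real.log (1 / (a * t)) + Real.log a = Real.log (1 / t) := by
    rw [← Real.log_mul (by positivity) ha.ne']
    congr 1; field_simp
  simp only [Function.comp_apply, h2]
  rw [Real.div_rpow]
  · refine (Real.log_pos ?_).le
    rw [← h2]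
    linarith [le_max_right 1 (1 - Real.log a)]
  · exact (Real.log_pos (lt_of_le_of_lt (le_max_left _ _) h1)).le

theorem ContPath.chungLiminf_le_rescale {θ : ℝ} (β h : ℝ) {a : ℝ} (ha : 0 < a) (x : ContPath) :
    ContPath.chungLiminf θ β (h + θ) x ≤
      ContPath.chungLiminf θ β (h + θ) (ContPath.rescale a h x) := by
  set G : ℝ → ENNReal := fun t => ENNReal.ofReal
    (ContPath.unitRunSup θ x t * (Real.log (Real.log (1 / t))) ^ β / t ^ (h + θ)) with hG
  set ρ : ℝ → ℝ := fun t => (Real.log (Real.log (1 / t))) ^ β /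
      (Real.log (Real.log (1 / (a * t)))) ^ β with hρ
  have hat : Tendsto (fun t : ℝ => a * t) (nhdsWithin 0 (Ioi 0)) (nhdsWithin 0 (Ioi 0)) := by
    refine tendsto_nhdsWithin_iff.2 ⟨?_, ?_⟩
    · have := ((continuous_const_mul a).tendsto 0).mono_left (nhdsWithin_le_nhds (s := Ioi 0))
      simpa using this
    · filter_upwards [self_mem_nhdsWithin] with t (ht : 0 < t)
      exact mul_pos ha ht
  have h1 : ContPath.chungLiminf θ β (h + θ) x ≤
      liminf (fun t => G (a * t)) (nhdsWithin 0 (Ioi 0)) := by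
    change liminf G _ ≤ liminf (G ∘ fun t => a * t) _
    rw [Filter.liminf_comp]
    exact liminf_le_liminf_of_le hat
  have h2 : liminf (fun t => ENNReal.ofReal (ρ t)) (nhdsWithin 0 (Ioi 0)) = 1 := by
    have := (ENNReal.continuous_ofReal.tendsto 1).comp (tendsto_log_log_ratio ha β)
    rw [ENNReal.ofReal_one] at this
    exact this.liminf_eq
  have h3 := ENNReal.le_liminf_mul (f := nhdsWithin (0:ℝ) (Ioi 0)) (u := fun t => G (a * t))
    (v := fun t => ENNReal.ofReal (ρ t))
  rw [h2, mul_one] at h3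
  refine h1.trans (h3.trans (le_of_eq ?_))
  refine liminf_congr ?_
  filter_upwards [self_mem_nhdsWithin,
    hat (Ioo_mem_nhdsGT (Real.exp_pos (-1)))] with t (ht : 0 < t) hat'
  have hw : 0 < (Real.log (Real.log (1 / (a * t)))) ^ β :=
    Real.rpow_pos_of_pos (log_log_one_div_pos hat').2 _
  have hM : 0 ≤ ContPath.unitRunSup θ x (a * t) := by
    refine Real.sSup_nonneg ?_
    rintro _ ⟨v, -, rfl⟩
    exact abs_nonneg _
  have hp : 0 < (a * t) ^ (h + θ) := Real.rpow_pos_of_pos hat'.1 _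
  simp only [Pi.mul_apply, hG]
  rw [← ENNReal.ofReal_mul (by positivity), ContPath.unitRunSup_rescale h ha, hρ]
  congr 1
  have e : a ^ (-(h + θ)) = (a ^ (h + θ))⁻¹ := Real.rpow_neg ha.le _
  have ha' := Real.rpow_pos_of_pos ha (h + θ)
  have ht' := Real.rpow_pos_of_pos ht (h + θ)
  rw [e, Real.mul_rpow ha.le ht.le]
  field_simp

theorem ContPath.chungLiminf_rescale {θ : ℝ} (β h : ℝ) {a : ℝ} (ha : 0 < a) (x : ContPath) :
    ContPath.chungLiminf θ β (h + θ) (ContPath.rescale a h x) =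
      ContPath.chungLiminf θ β (h + θ) x := by
  refine le_antisymm ?_ (ContPath.chungLiminf_le_rescale β h ha x)
  refine (ContPath.chungLiminf_le_rescale β h (inv_pos.2 ha) _).trans (le_of_eq ?_)
  congr 1
  refine Subtype.ext (funext fun t => ?_)
  simp only [ContPath.rescale]
  rw [Real.inv_rpow ha.le, mul_inv_cancel_left₀ ha.ne',
    inv_mul_cancel_left₀ (Real.rpow_pos_of_pos ha _).ne']

end Functional

section Modification

variable {Ω : Type*} [MeasurableSpace Ω] {P : Measure Ω} {X : ℝ → Ω → ℝ}

/-- A process on `[0, ∞)` with continuous paths and almost everywhere measurable marginals is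
almost surely given by a measurable map into the space of continuous paths. -/
theorem exists_measurable_contPath (hm : ∀ t, 0 ≤ t → AEMeasurable (X t) P)
    (hc : ∀ ω, ContinuousOn (fun t => X t ω) (Ici 0)) :
    ∃ Φ : Ω → ContPath, Measurable Φ ∧ ∀ᵐ ω ∂P, ∀ t, (Φ ω).1 t = X (max t 0) ω := by
  classical
  have hmq : ∀ q : ℚ, AEMeasurable (X (max (q : ℝ) 0)) P := fun q => hm _ (le_max_right _ _)
  have hae : ∀ᵐ ω ∂P, ∀ q : ℚ, X (max (q : ℝ) 0) ω = (hmq q).mk _ ω :=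
    ae_all_iff.2 fun q => (hmq q).ae_eq_mk
  obtain ⟨N, hN, hNm, hN0⟩ := exists_measurable_superset_of_null (ae_iff.1 hae)
  have hcont : ∀ ω, Continuous fun t : ℝ => X (max t 0) ω := fun ω =>
    (hc ω).comp_continuous (continuous_id.max continuous_const) fun t => mem_Ici.2 (le_max_right _ _)
  let Φ : Ω → ContPath := fun ω =>
    if ω ∈ N then ⟨fun _ => 0, continuous_const⟩ else ⟨fun t => X (max t 0) ω, hcont ω⟩
  have hΦN : ∀ ω, ω ∉ N → ∀ t, (Φ ω).1 t = X (max t 0) ω := fun ω hω t => by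
    simp only [Φ, if_neg hω]
  have hΦq : ∀ q : ℚ, Measurable fun ω => (Φ ω).1 q := by
    intro q
    have h : (fun ω => (Φ ω).1 q) = N.piecewise (fun _ => 0) ((hmq q).mk _) := by
      ext ω
      by_cases hω : ω ∈ N
      · simp [Φ, hω]
      · rw [hΦN ω hω, piecewise_eq_of_notMem _ _ _ hω]
        by_contra hne
        exact hω (hN fun h => hne (h q))
    rw [h]
    exact measurable_const.piecewise hNm (hmq q).measurable_mk
  refine ⟨Φ, Measurable.subtype_mk (measurable_pi_iff.2 fun t => ?_), ?_⟩
  · obtain ⟨u, -, -, hu⟩ := Real.exists_seq_rat_strictAnti_tendsto t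
    refine measurable_of_tendsto_metrizable (fun n => hΦq (u n)) (tendsto_pi_nhds.2 fun ω => ?_)
    exact ((Φ ω).2.tendsto t).comp hu
  · filter_upwards [measure_eq_zero_iff_ae_notMem.1 hN0] with ω hω using hΦN ω hω

theorem IsCenteredGaussianProcess.map_contPath (hG : IsCenteredGaussianProcess P X)
    {Φ : Ω → ContPath} (hΦ : Measurable Φ) (h : ∀ᵐ ω ∂P, ∀ t, (Φ ω).1 t = X (max t 0) ω) :
    IsCenteredGaussianProcess (P.map Φ) fun t x => x.1 t := by
  intro n t c
  obtain ⟨v, hv⟩ := hG n (fun i => max (t i) 0) c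
  refine ⟨v, ?_⟩
  rw [Measure.map_map (Finset.measurable_sum _ fun i _ =>
    (ContPath.measurable_eval (t i)).const_mul _) hΦ, ← hv]
  refine Measure.map_congr ?_
  filter_upwards [h] with ω hω
  simp [hω]

/-- If one of the variances vanishes, the covariances vanish too. -/
theorem IsCenteredGaussianProcess.integral_mul_eq_zero (hG : IsCenteredGaussianProcess P X)
    {s : ℝ} (hs : ∫ ω, X s ω * X s ω ∂P = 0) (t : ℝ) : ∫ ω, X s ω * X t ω ∂P = 0 := by
  rw [integral_eq_zero_iff_of_nonneg (fun ω => mul_self_nonneg _)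
    ((hG.memLp_two s).integrable_mul (hG.memLp_two s))] at hs
  refine integral_eq_zero_of_ae ?_
  filter_upwards [hs] with ω hω
  rw [mul_self_eq_zero.1 hω, zero_mul, Pi.zero_apply]

theorem IsGFBM.tendsto_gfbmCov_pow {α γ : ℝ} (hX : IsGFBM P α γ X) {a s t : ℝ} (ha : 0 < a)
    (ha1 : a < 1) (hs : 0 ≤ s) (ht : 0 ≤ t) :
    Tendsto (fun k : ℕ => (a ^ k) ^ (-(α - γ / 2 + 1 / 2)) * gfbmCov α γ (a ^ k * s) t)
      atTop (nhds 0) := by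
  obtain ⟨hG, -, -, hcov⟩ := hX
  by_cases hs0 : gfbmCov α γ s s = 0
  · refine tendsto_const_nhds.congr fun k => ?_
    have hk : 0 ≤ a ^ k * s := by positivity
    rw [← hcov _ _ hk ht, hG.integral_mul_eq_zero _ t, mul_zero]
    rw [hcov _ _ hk hk, gfbmCov_smul_smul _ _ _ _ (pow_pos ha k), hs0, mul_zero]
  by_cases ht0 : gfbmCov α γ t t = 0
  · refine tendsto_const_nhds.congr fun k => ?_
    have hk : 0 ≤ a ^ k * s := by positivity
    have h0 := hG.integral_mul_eq_zero ((hcov t t ht ht).trans ht0) (a ^ k * s)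
    simp_rw [mul_comm (X t _)] at h0
    rw [← hcov _ _ hk ht, h0, mul_zero]
  · exact (tendsto_gfbmCov_dilation hs0 ht0).comp (tendsto_nhdsWithin_iff.2
      ⟨tendsto_pow_atTop_nhds_zero_of_lt_one ha.le ha1, Eventually.of_forall fun k => pow_pos ha k⟩)

/-- The law of a generalized fractional Brownian motion is ergodic under rescaling. -/
theorem IsGFBM.ergodic_rescale {α γ : ℝ} [IsProbabilityMeasure P] (hX : IsGFBM P α γ X)
    {Φ : Ω → ContPath} (hΦ : Measurable Φ) (h : ∀ᵐ ω ∂P, ∀ t, (Φ ω).1 t = X (max t 0) ω)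
    {a : ℝ} (ha : 0 < a) (ha1 : a < 1) :
    Ergodic (ContPath.rescale a (α - γ / 2 + 1 / 2)) (P.map Φ) := by
  have := Measure.isProbabilityMeasure_map (μ := P) hΦ.aemeasurable
  have hmax : ∀ {b : ℝ}, 0 < b → ∀ s : ℝ, max (b * s) 0 = b * max s 0 := fun hb s => by
    rw [mul_max_of_nonneg _ _ hb.le, mul_zero]
  refine ContPath.ergodic_rescale (K := fun s t => gfbmCov α γ (max s 0) (max t 0)) ha
    (hX.1.map_contPath hΦ h) (fun s t => ?_) (fun s t => ?_) fun s t => ?_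
  · have hst : Measurable fun x : ContPath => x.1 s * x.1 t :=
      (ContPath.measurable_eval s).mul (ContPath.measurable_eval t)
    rw [integral_map hΦ.aemeasurable hst.aestronglyMeasurable,
      ← hX.2.2.2 _ _ (le_max_right s 0) (le_max_right t 0)]
    refine integral_congr_ae ?_
    filter_upwards [h] with ω hω
    rw [hω, hω]
  · rw [hmax ha, hmax ha, gfbmCov_smul_smul _ _ _ _ ha]
  · simp_rw [hmax (pow_pos ha _)]
    exact hX.tendsto_gfbmCov_pow ha ha1 (le_max_right _ _) (le_max_right _ _)

end Modification

/-- The running maximum of the fractional integral only depends on the path on `[0, ∞)`. -/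
theorem runSup_fracInt_eq_unitRunSup {Ω : Type*} {X : ℝ → Ω → ℝ} {θ : ℝ} (hθ : 0 < θ) {ω : Ω}
    {x : ContPath}
    (h : ∀ t, x.1 t = X (max t 0) ω) {t : ℝ} (ht : 0 < t) :
    runSup (fracInt θ X) t ω = ContPath.unitRunSup θ x t := by
  rw [← ContPath.runSup_eq_unitRunSup hθ ht]
  unfold runSup
  congr 1
  ext ⟨s, hs⟩
  unfold fracInt ContPath.eval
  congr 2
  refine intervalIntegral.integral_congr fun u hu => ?_
  rw [uIcc_of_le hs.1] at hu
  rw [h, max_eq_left hu.1]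

/-- Zero-one law at `0`: the liminf in Chung's LIL at the origin is an a.s. constant
in `[0, ∞]` (possibly `0` or `∞`). -/
theorem zeroOneLaw_zero
    {Ω : Type*} [MeasurableSpace Ω] (P : Measure Ω) [IsProbabilityMeasure P]
    (γ α θ H β : ℝ) (hγ : γ ∈ Set.Ico (0:ℝ) 1)
    (hα : α ∈ Set.Ioo (-1/2 + γ/2) (1/2)) (hθ : 0 < θ)
    (hH : H = α - γ/2 + 1/2) (hβ : β = α + θ + 1/2)
    (X : ℝ → Ω → ℝ) (hX : IsGFBM P α γ X)
    (Y : ℝ → Ω → ℝ) (hY : Y = fracInt θ X) :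
    ∃ κ₁' : ENNReal,
      ∀ᵐ ω ∂P, Filter.liminf
        (fun t : ℝ => ENNReal.ofReal
          (runSup Y t ω * (Real.log (Real.log (1 / t))) ^ β / t ^ (H + θ)))
        (nhdsWithin 0 (Set.Ioi 0)) = κ₁' := by
  obtain ⟨Φ, hΦ, h⟩ := exists_measurable_contPath (fun t _ => hX.1.aemeasurable t) hX.2.1
  have herg := hX.ergodic_rescale hΦ h one_half_pos one_half_lt_one
  rw [← hH] at herg
  obtain ⟨c, hc⟩ := herg.toPreErgodic.ae_eq_const_of_ae_eq_comp
    (ContPath.measurable_chungLiminf hθ β (H + θ))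
    (funext fun x => ContPath.chungLiminf_rescale β H one_half_pos x)
  refine ⟨c, ?_⟩
  filter_upwards [h, ae_of_ae_map hΦ.aemeasurable hc] with ω hω hcω
  rw [Function.const_apply] at hcω
  rw [← hcω]
  refine liminf_congr ?_
  filter_upwards [self_mem_nhdsWithin] with t ht
  rw [hY, runSup_fracInt_eq_unitRunSup hθ hω ht]
end

section
/- (Exponential decay of the Lamperti-transform covariance.) Define Q(t) = (1/Γ(θ)²) ∫₀^{e^t} ∫₀^1 (e^t − v)^{θ−1} (1 − u)^{θ−1} R(u, v) du dv for t ≥ 0 (this equals E[Y(e^t) Y(1)], the covariance of the fractional integrated GFBM). Then there exist constants C > 0 and κ > 0 such that e^{−(H+θ) t} · Q(t) ≤ C e^{−κ t} for all t ≥ 0; in particular one may take κ = min{α + 1/2 − γ/2, 1/2 − γ/2 − δ(1−α)} for any δ with (α−γ)₊/(1−α) < δ < (1/2 − γ/2)/(1 − α). -/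
open MeasureTheory Real Set

/-- The covariance kernel `R(u,v)` of the generalized fractional Brownian motion:
`R(u,v) = ∫₀^{u∧v} (u−x)^α (v−x)^α x^{−γ} dx
  + ∫₀^∞ ((u+x)^α − x^α)((v+x)^α − x^α) x^{−γ} dx`. -/
noncomputable def gfbmR (α γ u v : ℝ) : ℝ :=
  (∫ x in Set.Ioc 0 (min u v), (u - x) ^ α * (v - x) ^ α * x ^ (-γ)) +
  ∫ x in Set.Ioi (0:ℝ), ((u + x) ^ α - x ^ α) * ((v + x) ^ α - x ^ α) * x ^ (-γ)

/-- The Lamperti-transform covariance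
`Q(t) = (1/Γ(θ)²) ∫₀^{e^t} ∫₀^1 (e^t − v)^{θ−1} (1−u)^{θ−1} R(u,v) du dv`. -/
noncomputable def lampertiCov (α γ θ t : ℝ) : ℝ :=
  ((Real.Gamma θ) ^ 2)⁻¹ *
    ∫ v in Set.Ioc (0:ℝ) (Real.exp t),
      ∫ u in Set.Ioc (0:ℝ) 1,
        (Real.exp t - v) ^ (θ - 1) * (1 - u) ^ (θ - 1) * gfbmR α γ u v

/-- The function `b ↦ (b - x) ^ s` with `s > -1` is integrable up to the endpoint `b`, with the
expected integral. -/
lemma integrableOn_and_integral_sub_rpow {s b : ℝ} (hs : -1 < s) (hb : 0 ≤ b) :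
    IntegrableOn (fun x : ℝ => (b - x) ^ s) (Ioc 0 b) ∧
      ∫ x in Ioc 0 b, (b - x) ^ s = b ^ (s + 1) / (s + 1) := by
  constructor
  · have h := (intervalIntegral.intervalIntegrable_rpow' (a := b) (b := 0) hs).comp_sub_left b
    rw [sub_self, sub_zero, intervalIntegrable_iff_integrableOn_Ioc_of_le hb] at h
    exact h
  · rw [← intervalIntegral.integral_of_le hb,
      intervalIntegral.integral_comp_sub_left (fun x : ℝ => x ^ s), sub_self, sub_zero,
      integral_rpow (Or.inl hs), zero_rpow (by linarith), sub_zero]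

lemma integrableOn_and_integral_rpow {s b : ℝ} (hs : -1 < s) (hb : 0 ≤ b) :
    IntegrableOn (fun x : ℝ => x ^ s) (Ioc 0 b) ∧
      ∫ x in Ioc 0 b, x ^ s = b ^ (s + 1) / (s + 1) := by
  constructor
  · exact (intervalIntegrable_iff_integrableOn_Ioc_of_le hb).1
      (intervalIntegral.intervalIntegrable_rpow' hs)
  · rw [← intervalIntegral.integral_of_le hb, integral_rpow (Or.inl hs),
      zero_rpow (by linarith), sub_zero]

lemma setIntegral_le_of_nonneg_of_le {s : Set ℝ} (hs : MeasurableSet s) {f g : ℝ → ℝ}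
    (hf : ∀ x ∈ s, 0 ≤ f x) (hfg : ∀ x ∈ s, f x ≤ g x) (hg : IntegrableOn g s) :
    ∫ x in s, f x ≤ ∫ x in s, g x :=
  integral_mono_of_nonneg ((ae_restrict_iff' hs).2 (.of_forall hf)) hg
    ((ae_restrict_iff' hs).2 (.of_forall hfg))

/-- A nonnegative function on the half-line dominated by `K * x ^ p` near `0` and `K * x ^ q`
near infinity has integral at most a constant multiple of `K`. -/
lemma exists_integral_Ioi_le {p q : ℝ} (hp : -1 < p) (hq : q < -1) :
    ∃ C : ℝ, 0 ≤ C ∧ ∀ (f : ℝ → ℝ) (K : ℝ), (∀ x, 0 < x → 0 ≤ f x) →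
      (∀ x, 0 < x → x ≤ 1 → f x ≤ K * x ^ p) → (∀ x, 1 < x → f x ≤ K * x ^ q) →
      ∫ x in Ioi (0 : ℝ), f x ≤ C * K := by
  let g : ℝ → ℝ := fun x => if x ≤ 1 then x ^ p else x ^ q
  have hg : IntegrableOn g (Ioi 0) := by
    rw [← Ioc_union_Ioi_eq_Ioi zero_le_one, integrableOn_union]
    constructor
    · exact (integrableOn_and_integral_rpow hp zero_le_one).1.congr_fun
        (fun x hx => (if_pos hx.2).symm) measurableSet_Ioc
    · exact (integrableOn_Ioi_rpow_of_lt hq zero_lt_one).congr_fun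
        (fun x hx => (if_neg (not_le.2 hx)).symm) measurableSet_Ioi
  refine ⟨∫ x in Ioi 0, g x, setIntegral_nonneg measurableSet_Ioi fun x hx => ?_, ?_⟩
  · have : (0 : ℝ) ≤ x := le_of_lt hx
    dsimp only [g]
    split_ifs <;> positivity
  · intro f K hf h0 h1
    rw [mul_comm, ← integral_const_mul]
    refine setIntegral_le_of_nonneg_of_le measurableSet_Ioi hf (fun x hx => ?_) (hg.const_mul K)
    dsimp only [g]
    split_ifs with h
    · exact h0 x hx h
    · exact h1 x (not_le.1 h)

lemma gfbmR_incr_mul_nonneg {α u v x : ℝ} (hu : 0 ≤ u) (hv : 0 ≤ v) (hx : 0 < x) :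
    0 ≤ ((u + x) ^ α - x ^ α) * ((v + x) ^ α - x ^ α) := by
  rcases le_total 0 α with h | h
  · exact mul_nonneg (sub_nonneg.2 (rpow_le_rpow hx.le (by linarith) h))
      (sub_nonneg.2 (rpow_le_rpow hx.le (by linarith) h))
  · exact mul_nonneg_of_nonpos_of_nonpos
      (sub_nonpos.2 (rpow_le_rpow_of_nonpos hx (by linarith) h))
      (sub_nonpos.2 (rpow_le_rpow_of_nonpos hx (by linarith) h))

lemma gfbmR_nonneg {α γ u v : ℝ} (hu : 0 ≤ u) (hv : 0 ≤ v) : 0 ≤ gfbmR α γ u v := by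
  refine add_nonneg (setIntegral_nonneg measurableSet_Ioc fun x hx => ?_)
    (setIntegral_nonneg measurableSet_Ioi fun x hx => ?_)
  · have hxu : 0 ≤ u - x := sub_nonneg.2 (hx.2.trans (min_le_left _ _))
    have hxv : 0 ≤ v - x := sub_nonneg.2 (hx.2.trans (min_le_right _ _))
    have hx0 := hx.1.le
    positivity
  · exact mul_nonneg (gfbmR_incr_mul_nonneg hu hv hx) (rpow_nonneg (le_of_lt hx) _)

lemma add_rpow_sub_rpow_le {α T x : ℝ} (hα : 0 ≤ α) (hα1 : α ≤ 1) (hT : 0 ≤ T) (hx : 0 < x) :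
    (T + x) ^ α - x ^ α ≤ T * x ^ (α - 1) := by
  have h := rpow_one_add_le_one_add_mul_self (s := T / x) (p := α)
    (by have : 0 ≤ T / x := by positivity
        linarith) hα hα1
  have e : T + x = x * (1 + T / x) := by field_simp; ring
  have hTx : 0 ≤ T / x := by positivity
  rw [e, mul_rpow hx.le (by positivity), rpow_sub_one hx.ne']
  have : (1 + T / x) ^ α ≤ 1 + T / x := h.trans (by nlinarith)
  have := mul_le_mul_of_nonneg_left this (rpow_nonneg hx.le α)
  have e2 : T * (x ^ α / x) = x ^ α * (T / x) := by ring
  rw [e2]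
  linarith

lemma rpow_sub_one_add_rpow_le {α x : ℝ} (hα : -1 ≤ α) (hx : 0 < x) :
    x ^ α - (1 + x) ^ α ≤ x ^ (α - 1) := by
  have h : x ^ α * (1 + 1 / x) ^ (-1 : ℝ) ≤ x ^ α * (1 + 1 / x) ^ α := by
    gcongr
    have : 0 ≤ 1 / x := by positivity
    linarith
  rw [← mul_rpow hx.le (by positivity), show x * (1 + 1 / x) = 1 + x by field_simp; ring,
    rpow_neg_one] at h
  have e : x ^ α * (1 + 1 / x)⁻¹ = x ^ α - x ^ α / (1 + x) := by field_simp; ring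
  have h2 : x ^ α / (1 + x) ≤ x ^ α / x := by gcongr; linarith
  rw [rpow_sub_one hx.ne']
  linarith

/-- Interpolation between `(T + x) ^ α - x ^ α ≤ T ^ α` and
`(T + x) ^ α - x ^ α ≤ T * x ^ (α - 1)`. -/
lemma add_rpow_sub_rpow_le_interpolate {α δ T x : ℝ} (hα : 0 ≤ α) (hα1 : α ≤ 1) (hδ : 0 ≤ δ)
    (hδ1 : δ ≤ 1) (hT : 0 < T) (hx : 0 < x) :
    (T + x) ^ α - x ^ α ≤ T ^ (α + δ * (1 - α)) * x ^ (-(δ * (1 - α))) := by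
  set d := (T + x) ^ α - x ^ α
  have hd0 : 0 ≤ d := sub_nonneg.2 (rpow_le_rpow hx.le (by linarith) hα)
  have h1 : d ≤ T ^ α := by
    have := rpow_add_le_add_rpow hT.le hx.le hα hα1
    linarith
  have h2 : d ≤ T * x ^ (α - 1) := add_rpow_sub_rpow_le hα hα1 hT.le hx
  calc d = d ^ (1 - δ) * d ^ δ := by
        rw [← rpow_add' hd0 (by norm_num), sub_add_cancel, rpow_one]
    _ ≤ (T ^ α) ^ (1 - δ) * (T * x ^ (α - 1)) ^ δ := by
        gcongr
    _ = T ^ (α + δ * (1 - α)) * x ^ (-(δ * (1 - α))) := by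
        rw [mul_rpow hT.le (by positivity), ← rpow_mul hT.le, ← rpow_mul hx.le, ← mul_assoc,
          ← rpow_add hT]
        ring_nf

/-- For `α ≥ 0` the covariance kernel over `(0, 1] × (0, T]` grows at most like
`T ^ (α + δ * (1 - α))`. -/
lemma exists_gfbmR_le_of_nonneg {α γ δ : ℝ} (hα : 0 ≤ α) (hα1 : α ≤ 1) (hγ : γ < 1)
    (hδ : 0 ≤ δ) (hδ1 : δ ≤ 1) (hlow : α - γ < δ * (1 - α)) (hup : δ * (1 - α) < 1 - γ) :
    ∃ C : ℝ, 0 ≤ C ∧ ∀ T : ℝ, 1 ≤ T → ∀ u ∈ Ioc (0 : ℝ) 1, ∀ v ∈ Ioc (0 : ℝ) T,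
      gfbmR α γ u v ≤ C * T ^ (α + δ * (1 - α)) := by
  obtain ⟨C, hC, hbound⟩ := exists_integral_Ioi_le (p := -(δ * (1 - α)) - γ)
    (q := α - 1 - δ * (1 - α) - γ) (by linarith) (by linarith)
  have hδα : 0 ≤ δ * (1 - α) := mul_nonneg hδ (by linarith)
  refine ⟨1 / (1 - γ) + C, add_nonneg (one_div_nonneg.2 (by linarith)) hC, ?_⟩
  intro T hT u hu v hv
  have hT0 : 0 < T := by linarith
  rw [add_mul]
  refine add_le_add ?_ (hbound _ _ (fun x hx => ?_) (fun x hx hx1 => ?_) (fun x hx => ?_))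
  · have hm : 0 ≤ min u v := le_min hu.1.le hv.1.le
    have hI := integrableOn_and_integral_rpow (s := -γ) (by linarith) hm
    calc ∫ x in Ioc 0 (min u v), (u - x) ^ α * (v - x) ^ α * x ^ (-γ)
        ≤ ∫ x in Ioc 0 (min u v), T ^ α * x ^ (-γ) := by
          refine setIntegral_le_of_nonneg_of_le measurableSet_Ioc (fun x hx => ?_)
            (fun x hx => ?_) (hI.1.const_mul _)
          all_goals
            have hxu : 0 ≤ u - x := sub_nonneg.2 (hx.2.trans (min_le_left _ _))
            have hxv : 0 ≤ v - x := sub_nonneg.2 (hx.2.trans (min_le_right _ _))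
            have hx0 := hx.1.le
          · positivity
          · have h1 : (u - x) ^ α ≤ 1 := rpow_le_one hxu (by linarith [hu.2]) hα
            have h2 : (v - x) ^ α ≤ T ^ α := rpow_le_rpow hxv (by linarith [hv.2]) hα
            have h3 := mul_le_mul h1 h2 (by positivity) zero_le_one
            rw [one_mul] at h3
            gcongr
      _ = T ^ α * ((min u v) ^ (-γ + 1) / (-γ + 1)) := by rw [integral_const_mul, hI.2]
      _ ≤ T ^ (α + δ * (1 - α)) * (1 / (-γ + 1)) := by
          have : 0 < -γ + 1 := by linarith
          gcongr
          · linarith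
          · exact rpow_le_one hm ((min_le_left _ _).trans hu.2) this.le
      _ = 1 / (1 - γ) * T ^ (α + δ * (1 - α)) := by ring_nf
  · exact mul_nonneg (gfbmR_incr_mul_nonneg hu.1.le hv.1.le hx) (rpow_nonneg hx.le _)
  all_goals
    have hx0 : 0 < x := by linarith
    have hf0 : 0 ≤ (v + x) ^ α - x ^ α :=
      sub_nonneg.2 (rpow_le_rpow hx0.le (by linarith [hv.1]) hα)
    have hf : (v + x) ^ α - x ^ α ≤ T ^ (α + δ * (1 - α)) * x ^ (-(δ * (1 - α))) :=
      (sub_le_sub_right (rpow_le_rpow (by linarith [hv.1]) (by linarith [hv.2]) hα) _).trans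
        (add_rpow_sub_rpow_le_interpolate hα hα1 hδ hδ1 hT0 hx0)
  · have h1 : (u + x) ^ α - x ^ α ≤ 1 := by
      have := rpow_add_le_add_rpow hu.1.le hx.le hα hα1
      have := rpow_le_one hu.1.le hu.2 hα
      linarith
    calc _ ≤ 1 * (T ^ (α + δ * (1 - α)) * x ^ (-(δ * (1 - α)))) * x ^ (-γ) := by gcongr
      _ = _ := by rw [one_mul, mul_assoc, ← rpow_add hx0]; ring_nf
  · have h1 : (u + x) ^ α - x ^ α ≤ x ^ (α - 1) :=
      (add_rpow_sub_rpow_le hα hα1 hu.1.le hx0).trans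
        (mul_le_of_le_one_left (rpow_nonneg hx0.le _) hu.2)
    calc _ ≤ x ^ (α - 1) * (T ^ (α + δ * (1 - α)) * x ^ (-(δ * (1 - α)))) * x ^ (-γ) := by
          gcongr
      _ = T ^ (α + δ * (1 - α)) * (x ^ (α - 1) * x ^ (-(δ * (1 - α))) * x ^ (-γ)) := by ring
      _ = _ := by rw [← rpow_add hx0, ← rpow_add hx0]; ring_nf

/-- For `α < 0` the covariance kernel is bounded over `(0, 1] × (0, ∞)`. -/
lemma exists_gfbmR_le_of_neg {α γ : ℝ} (hα : α < 0) (hγ0 : 0 ≤ γ)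
    (hαγ : -1 < 2 * α - γ) :
    ∃ C : ℝ, 0 ≤ C ∧ ∀ u ∈ Ioc (0 : ℝ) 1, ∀ v : ℝ, 0 < v → gfbmR α γ u v ≤ C := by
  obtain ⟨C, hC, hbound⟩ := exists_integral_Ioi_le (p := 2 * α - γ)
    (q := 2 * α - γ - 1) hαγ (by linarith)
  refine ⟨2 / (2 * α - γ + 1) + C, add_nonneg (div_nonneg zero_le_two (by linarith)) hC, ?_⟩
  intro u hu v hv
  rw [← mul_one C]
  refine add_le_add ?_ (hbound _ _ (fun x hx => ?_) (fun x hx hx1 => ?_) (fun x hx => ?_))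
  · set m := min u v
    have hm : 0 ≤ m := le_min hu.1.le hv.le
    have hI := integrableOn_and_integral_rpow hαγ hm
    have hJ := integrableOn_and_integral_sub_rpow hαγ hm
    calc ∫ x in Ioc 0 m, (u - x) ^ α * (v - x) ^ α * x ^ (-γ)
        = ∫ x in Ioo 0 m, (u - x) ^ α * (v - x) ^ α * x ^ (-γ) := integral_Ioc_eq_integral_Ioo
      _ ≤ ∫ x in Ioo 0 m, ((m - x) ^ (2 * α - γ) + x ^ (2 * α - γ)) := by
          refine setIntegral_le_of_nonneg_of_le measurableSet_Ioo (fun x hx => ?_)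
            (fun x hx => ?_) ((hJ.1.add hI.1).mono_set Ioo_subset_Ioc_self)
          all_goals
            have hx0 := hx.1
            have hmx : 0 < m - x := sub_pos.2 hx.2
            have hxu : m - x ≤ u - x := sub_le_sub_right (min_le_left _ _) _
            have hxv : m - x ≤ v - x := sub_le_sub_right (min_le_right _ _) _
            have hxu' := hmx.trans_le hxu
            have hxv' := hmx.trans_le hxv
          · positivity
          · have h1 := rpow_le_rpow_of_nonpos hmx hxu hα.le
            have h2 := rpow_le_rpow_of_nonpos hmx hxv hα.le
            have key : ∀ y : ℝ, 0 < y → y ^ α * y ^ α * y ^ (-γ) = y ^ (2 * α - γ) := by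
              intro y hy
              rw [← rpow_add hy, ← rpow_add hy]
              ring_nf
            calc _ ≤ (m - x) ^ α * (m - x) ^ α * x ^ (-γ) := by gcongr
              _ ≤ _ := by
                rw [← key _ hmx, ← key _ hx0]
                rcases le_total (m - x) x with h | h
                · have h3 := rpow_le_rpow_of_nonpos hmx h (neg_nonpos.2 hγ0)
                  refine le_add_of_le_of_nonneg ?_ (by positivity)
                  gcongr
                · have h3 := rpow_le_rpow_of_nonpos hx0 h hα.le
                  refine le_add_of_nonneg_of_le (by positivity) ?_
                  gcongr
      _ = m ^ (2 * α - γ + 1) / (2 * α - γ + 1) + m ^ (2 * α - γ + 1) / (2 * α - γ + 1) := by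
          rw [← integral_Ioc_eq_integral_Ioo, integral_add hJ.1 hI.1, hI.2, hJ.2]
      _ ≤ 1 / (2 * α - γ + 1) + 1 / (2 * α - γ + 1) := by
          have : 0 < 2 * α - γ + 1 := by linarith
          have h1 : m ^ (2 * α - γ + 1) ≤ 1 :=
            rpow_le_one hm ((min_le_left _ _).trans hu.2) this.le
          gcongr
      _ = 2 / (2 * α - γ + 1) := by ring
  · exact mul_nonneg (gfbmR_incr_mul_nonneg hu.1.le hv.le hx) (rpow_nonneg hx.le _)
  all_goals
    have hx0 : 0 < x := by linarith
    have hv0 : 0 ≤ x ^ α - (v + x) ^ α :=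
      sub_nonneg.2 (rpow_le_rpow_of_nonpos hx0 (by linarith) hα.le)
    have hv1 : x ^ α - (v + x) ^ α ≤ x ^ α :=
      sub_le_self _ (rpow_nonneg (by linarith) _)
    rw [show ((u + x) ^ α - x ^ α) * ((v + x) ^ α - x ^ α) =
      (x ^ α - (u + x) ^ α) * (x ^ α - (v + x) ^ α) by ring, one_mul]
  · have h1 : x ^ α - (u + x) ^ α ≤ x ^ α :=
      sub_le_self _ (rpow_nonneg (by linarith [hu.1]) _)
    calc _ ≤ x ^ α * x ^ α * x ^ (-γ) := by gcongr
      _ = _ := by rw [← rpow_add hx0, ← rpow_add hx0]; ring_nf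
  · have h1 : x ^ α - (u + x) ^ α ≤ x ^ (α - 1) :=
      (sub_le_sub_left (rpow_le_rpow_of_nonpos (by linarith [hu.1])
        (by linarith [hu.2]) hα.le) _).trans (rpow_sub_one_add_rpow_le (by linarith) hx0)
    calc _ ≤ x ^ (α - 1) * x ^ α * x ^ (-γ) := by gcongr
      _ = _ := by rw [← rpow_add hx0, ← rpow_add hx0]; ring_nf

/-- A uniform bound `K` on the covariance kernel over `(0, 1] × (0, e ^ t]` bounds the covariance
of the fractional integrals. -/
lemma lampertiCov_le_of_gfbmR_le {α γ θ t K : ℝ} (hθ : 0 < θ)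
    (hK : ∀ u ∈ Ioc (0 : ℝ) 1, ∀ v ∈ Ioc (0 : ℝ) (exp t), gfbmR α γ u v ≤ K) :
    lampertiCov α γ θ t ≤ ((Gamma θ) ^ 2)⁻¹ * (K / θ ^ 2 * exp (θ * t)) := by
  have hI := integrableOn_and_integral_sub_rpow (s := θ - 1) (b := 1) (by linarith) zero_le_one
  have hJ := integrableOn_and_integral_sub_rpow (s := θ - 1) (b := exp t) (by linarith)
    (exp_pos t).le
  rw [sub_add_cancel, one_rpow] at hI
  rw [sub_add_cancel, ← exp_mul] at hJ
  have hnonneg : ∀ v ∈ Ioc (0 : ℝ) (exp t), ∀ u ∈ Ioc (0 : ℝ) 1,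
      0 ≤ (exp t - v) ^ (θ - 1) * (1 - u) ^ (θ - 1) * gfbmR α γ u v := fun v hv u hu =>
    mul_nonneg (mul_nonneg (rpow_nonneg (sub_nonneg.2 hv.2) _)
      (rpow_nonneg (sub_nonneg.2 hu.2) _)) (gfbmR_nonneg hu.1.le hv.1.le)
  refine mul_le_mul_of_nonneg_left ?_ (by positivity)
  calc _ ≤ ∫ v in Ioc (0 : ℝ) (exp t), K / θ * (exp t - v) ^ (θ - 1) := by
        refine setIntegral_le_of_nonneg_of_le measurableSet_Ioc
          (fun v hv => setIntegral_nonneg measurableSet_Ioc (hnonneg v hv))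
          (fun v hv => ?_) (hJ.1.const_mul _)
        calc _ ≤ ∫ u in Ioc (0 : ℝ) 1, (exp t - v) ^ (θ - 1) * K * (1 - u) ^ (θ - 1) := by
              refine setIntegral_le_of_nonneg_of_le measurableSet_Ioc (hnonneg v hv)
                (fun u hu => ?_) (hI.1.const_mul _)
              rw [mul_right_comm _ K]
              exact mul_le_mul_of_nonneg_left (hK u hu v hv)
                (mul_nonneg (rpow_nonneg (sub_nonneg.2 hv.2) _)
                  (rpow_nonneg (sub_nonneg.2 hu.2) _))
          _ = _ := by rw [integral_const_mul, hI.2]; ring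
    _ = _ := by rw [integral_const_mul, hJ.2, mul_comm t θ]; ring

lemma exists_lampertiCov_le_exp {α γ θ e : ℝ} (hθ : 0 < θ)
    (hR : ∃ C : ℝ, 0 ≤ C ∧ ∀ T : ℝ, 1 ≤ T → ∀ u ∈ Ioc (0 : ℝ) 1, ∀ v ∈ Ioc (0 : ℝ) T,
      gfbmR α γ u v ≤ C * T ^ e) :
    ∃ C : ℝ, 0 < C ∧ ∀ t : ℝ, 0 ≤ t → lampertiCov α γ θ t ≤ C * exp ((θ + e) * t) := by
  obtain ⟨C, hC, h⟩ := hR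
  refine ⟨((Gamma θ) ^ 2)⁻¹ * (C / θ ^ 2) + 1, by positivity, fun t ht => ?_⟩
  refine (lampertiCov_le_of_gfbmR_le hθ (h _ (one_le_exp ht))).trans ?_
  rw [show (θ + e) * t = t * e + θ * t by ring, exp_add, ← exp_mul]
  have : 0 < exp (t * e) * exp (θ * t) := by positivity
  linear_combination this

/-- Exponential decay of the Lamperti-transform covariance: there exist `C > 0` and
`κ > 0` with `e^{−(H+θ)t} Q(t) ≤ C e^{−κt}` for all `t ≥ 0`; in fact one may take
`κ = min(α + 1/2 − γ/2, 1/2 − γ/2 − δ(1−α))` for any admissible `δ`. -/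
theorem lampertiCov_exponential_decay
    (γ α θ H : ℝ) (hγ : γ ∈ Set.Ico (0:ℝ) 1)
    (hα : α ∈ Set.Ioo (-1/2 + γ/2) (1/2)) (hθ : 0 < θ)
    (hH : H = α - γ/2 + 1/2) :
    (∃ C : ℝ, 0 < C ∧ ∃ κ : ℝ, 0 < κ ∧ ∀ t : ℝ, 0 ≤ t →
      Real.exp (-(H + θ) * t) * lampertiCov α γ θ t ≤ C * Real.exp (-κ * t)) ∧
    ∀ δ : ℝ, max (α - γ) 0 / (1 - α) < δ → δ < (1/2 - γ/2) / (1 - α) →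
      ∃ C : ℝ, 0 < C ∧ ∀ t : ℝ, 0 ≤ t →
        Real.exp (-(H + θ) * t) * lampertiCov α γ θ t ≤
          C * Real.exp (-(min (α + 1/2 - γ/2) (1/2 - γ/2 - δ * (1 - α))) * t) := by
  have hα' := hα.1
  have hα1 : 0 < 1 - α := by linarith [hα.2]
  have hγ0 := hγ.1
  have hγ1 := hγ.2
  have decay : ∀ δ : ℝ, max (α - γ) 0 / (1 - α) < δ → δ < (1/2 - γ/2) / (1 - α) →
      ∃ C : ℝ, 0 < C ∧ ∀ t : ℝ, 0 ≤ t →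
        Real.exp (-(H + θ) * t) * lampertiCov α γ θ t ≤
          C * Real.exp (-(min (α + 1/2 - γ/2) (1/2 - γ/2 - δ * (1 - α))) * t) := by
    intro δ hδ1 hδ2
    rw [div_lt_iff₀ hα1] at hδ1
    rw [lt_div_iff₀ hα1] at hδ2
    have hδα : 0 < δ * (1 - α) := (le_max_right _ _).trans_lt hδ1
    have hδ0 : 0 < δ := pos_of_mul_pos_left hδα hα1.le
    have hδ1' : δ ≤ 1 := by nlinarith [hα.2]
    obtain ⟨e, he, hR⟩ : ∃ e : ℝ, e ≤ max 0 (α + δ * (1 - α)) ∧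
        ∃ C : ℝ, 0 ≤ C ∧ ∀ T : ℝ, 1 ≤ T → ∀ u ∈ Ioc (0 : ℝ) 1, ∀ v ∈ Ioc (0 : ℝ) T,
          gfbmR α γ u v ≤ C * T ^ e := by
      rcases lt_or_ge α 0 with h | h
      · obtain ⟨C, hC, hb⟩ := exists_gfbmR_le_of_neg (α := α) h hγ0 (by linarith)
        refine ⟨0, le_max_left _ _, C, hC, fun T _ u hu v hv => ?_⟩
        simpa using hb u hu v hv.1
      · exact ⟨_, le_max_right _ _, exists_gfbmR_le_of_nonneg h (by linarith) hγ1 hδ0.le hδ1'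
          ((le_max_left _ _).trans_lt hδ1) (by linarith)⟩
    obtain ⟨C, hC, hQ⟩ := exists_lampertiCov_le_exp hθ hR
    refine ⟨C, hC, fun t ht => ?_⟩
    have hexp : -(H + θ) + (θ + e) ≤ -(min (α + 1/2 - γ/2) (1/2 - γ/2 - δ * (1 - α))) := by
      rcases le_max_iff.1 he with h | h
      · linarith [min_le_left (α + 1/2 - γ/2) (1/2 - γ/2 - δ * (1 - α))]
      · linarith [min_le_right (α + 1/2 - γ/2) (1/2 - γ/2 - δ * (1 - α))]
    calc _ ≤ Real.exp (-(H + θ) * t) * (C * Real.exp ((θ + e) * t)) := by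
          gcongr
          exact hQ t ht
      _ = C * Real.exp ((-(H + θ) + (θ + e)) * t) := by
          rw [add_mul _ (θ + e), Real.exp_add]
          ring
      _ ≤ _ := by gcongr
  refine ⟨?_, decay⟩
  obtain ⟨δ, hδ1, hδ2⟩ := exists_between (show max (α - γ) 0 / (1 - α) < (1/2 - γ/2) / (1 - α) from
    div_lt_div_of_pos_right (max_lt (by linarith [hα.2]) (by linarith)) hα1)
  obtain ⟨C, hC, h⟩ := decay δ hδ1 hδ2
  rw [lt_div_iff₀ hα1] at hδ2
  exact ⟨C, hC, _, lt_min (by linarith) (by linarith), h⟩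
end
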